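/- arXiv:math/0408069 — 4 statements merged into one kernel-verified Lean document; each statement's English description precedes it below -/
import Mathlib

section
/- Let K be a field of characteristic different from 2 and let M be a symmetric 4×4 matrix over K defining a non-singular quadric surface Q in P^3. The two rulings of lines on Q are each individually defined over K if and only if det(M) is a square in K; otherwise they are conjugate over a quadratic extension of K. -/
open Matrix

/-- The componentwise action of a `K`-automorphism `σ` of the algebraic closure on the
vector space `(K̄)⁴`, as a `σ`-semilinear map. -/
noncomputable def galMap {K : Type*} [Field K]
    (σ : AlgebraicClosure K ≃ₐ[K] AlgebraicClosure K) :
    (Fin 4 → AlgebraicClosure K) →ₛₗ[((σ : AlgebraicClosure K ≃+* AlgebraicClosure K) :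
        AlgebraicClosure K →+* AlgebraicClosure K)] (Fin 4 → AlgebraicClosure K) where
  toFun x := fun i => σ (x i)
  map_add' x y := by funext i; simp
  map_smul' c x := by funext i; simp [Pi.smul_apply, smul_eq_mul, _root_.map_mul]

/-- The induced action of the Galois group on subspaces of `(K̄)⁴` (in particular on the
lines of `P³` over `K̄`). -/
noncomputable def galActSub {K : Type*} [Field K]
    (σ : AlgebraicClosure K ≃ₐ[K] AlgebraicClosure K)
    (W : Submodule (AlgebraicClosure K) (Fin 4 → AlgebraicClosure K)) :
    Submodule (AlgebraicClosure K) (Fin 4 → AlgebraicClosure K) :=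
  haveI : RingHomSurjective ((σ : AlgebraicClosure K ≃+* AlgebraicClosure K) :
      AlgebraicClosure K →+* AlgebraicClosure K) := ⟨σ.surjective⟩
  W.map (galMap σ)

section Rulings

variable {F : Type*} [Field F]

/-- The rows `x, y, u, v` of `A` satisfy: `u, v` span a totally isotropic subspace for the
bilinear form of `M`, and `x, y` are dual to `u, v`. -/
structure IsDualFrame (M A : Matrix (Fin 4) (Fin 4) F) : Prop where
  h02 : M.toBilin' (A 0) (A 2) = 1
  h03 : M.toBilin' (A 0) (A 3) = 0
  h12 : M.toBilin' (A 1) (A 2) = 0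
  h13 : M.toBilin' (A 1) (A 3) = 1
  h22 : M.toBilin' (A 2) (A 2) = 0
  h23 : M.toBilin' (A 2) (A 3) = 0
  h33 : M.toBilin' (A 3) (A 3) = 0

/-- The totally isotropic planes all of whose dual frames have determinant `ε⁻¹`. -/
def ruling (M : Matrix (Fin 4) (Fin 4) F) (ε : F) : Set (Submodule F (Fin 4 → F)) :=
  {W | Module.finrank F W = 2 ∧ (∀ x ∈ W, x ⬝ᵥ M *ᵥ x = 0) ∧
    ∀ A, IsDualFrame M A → A 2 ∈ W → A 3 ∈ W → ε * A.det = 1}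

variable {M : Matrix (Fin 4) (Fin 4) F}

lemma toBilin'_comm (hsym : M.IsSymm) (x y : Fin 4 → F) :
    M.toBilin' x y = M.toBilin' y x :=
  (Matrix.isSymm_toBilin'_iff_isSymm.mpr hsym).eq x y

lemma IsDualFrame.det_sq (hsym : M.IsSymm) {A : Matrix (Fin 4) (Fin 4) F}
    (h : IsDualFrame M A) : A.det ^ 2 * M.det = 1 := by
  have hG : ∀ i j, (A * M * Aᵀ) i j = M.toBilin' (A i) (A j) := fun i j => by
    rw [Matrix.mul_mul_apply, Matrix.toBilin'_apply']; rfl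
  have hd : (A * M * Aᵀ).det = 1 := by
    rw [Matrix.det_succ_row_zero]
    simp [Fin.sum_univ_succ, Matrix.det_fin_three, hG, Fin.succAbove,
      toBilin'_comm hsym (A 2) (A 0), toBilin'_comm hsym (A 2) (A 1),
      toBilin'_comm hsym (A 3) (A 0), toBilin'_comm hsym (A 3) (A 1),
      toBilin'_comm hsym (A 3) (A 2), h.h02, h.h03, h.h12, h.h13, h.h22, h.h23, h.h33]
  rw [Matrix.det_mul, Matrix.det_mul, Matrix.det_transpose] at hd
  linear_combination hd

lemma IsDualFrame.det_ne_zero (hsym : M.IsSymm) {A : Matrix (Fin 4) (Fin 4) F}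
    (h : IsDualFrame M A) : A.det ≠ 0 := by
  intro h0
  simpa [h0] using h.det_sq hsym

lemma IsDualFrame.exists_coeff (hsym : M.IsSymm) {A : Matrix (Fin 4) (Fin 4) F}
    (h : IsDualFrame M A) (w : Fin 4 → F) :
    ∃ c : Fin 4 → F, w = c ᵥ* A ∧
      w = c 0 • A 0 + c 1 • A 1 + c 2 • A 2 + c 3 • A 3 ∧
      M.toBilin' w (A 2) = c 0 ∧ M.toBilin' w (A 3) = c 1 := by
  obtain ⟨c, rfl⟩ := Matrix.vecMul_surjective_iff_isUnit.mpr
    ((Matrix.isUnit_iff_isUnit_det A).mpr (h.det_ne_zero hsym).isUnit) w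
  have hc : c ᵥ* A = c 0 • A 0 + c 1 • A 1 + c 2 • A 2 + c 3 • A 3 := by
    rw [Matrix.vecMul_eq_sum, Fin.sum_univ_four]
  refine ⟨c, rfl, hc, ?_, ?_⟩ <;> simp only [hc] <;>
    simp [h.h02, h.h03, h.h12, h.h13, h.h22, h.h23, h.h33, toBilin'_comm hsym (A 3) (A 2)]

lemma IsDualFrame.det_eq (hsym : M.IsSymm) {A A' : Matrix (Fin 4) (Fin 4) F}
    (h : IsDualFrame M A) (h' : IsDualFrame M A')
    (h22 : M.toBilin' (A' 2) (A 2) = 0) (h23 : M.toBilin' (A' 2) (A 3) = 0)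
    (h32 : M.toBilin' (A' 3) (A 2) = 0) (h33 : M.toBilin' (A' 3) (A 3) = 0) :
    A'.det = A.det := by
  choose C hC hC' hC2 hC3 using fun i => h.exists_coeff hsym (A' i)
  have hA' : A' = Matrix.of C * A := by
    ext i j; rw [hC i]; rfl
  have c20 : C 2 0 = 0 := by rw [← hC2, h22]
  have c21 : C 2 1 = 0 := by rw [← hC3, h23]
  have c30 : C 3 0 = 0 := by rw [← hC2, h32]
  have c31 : C 3 1 = 0 := by rw [← hC3, h33]
  have e2 : A' 2 = C 2 2 • A 2 + C 2 3 • A 3 := by simpa [c20, c21] using hC' 2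
  have e3 : A' 3 = C 3 2 • A 2 + C 3 3 • A 3 := by simpa [c30, c31] using hC' 3
  have e02 := h'.h02
  have e03 := h'.h03
  have e12 := h'.h12
  have e13 := h'.h13
  simp only [e2, e3, map_add, map_smul, hC2, hC3, smul_eq_mul] at e02 e03 e12 e13
  have hd : (Matrix.of C).det = 1 := by
    rw [Matrix.det_succ_row_zero]
    simp [Fin.sum_univ_succ, Matrix.det_fin_three, Fin.succAbove, c20, c21, c30, c31]
    linear_combination (C 0 0 * C 2 2 + C 0 1 * C 2 3) * e13 + e02 -
      (C 0 0 * C 3 2 + C 0 1 * C 3 3) * e12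
  rw [hA', Matrix.det_mul, hd, one_mul]

lemma toBilin'_eq_zero_of_isotropic (h2 : (2 : F) ≠ 0) (hsym : M.IsSymm)
    {W : Submodule F (Fin 4 → F)} (hW : ∀ x ∈ W, x ⬝ᵥ M *ᵥ x = 0)
    {x y : Fin 4 → F} (hx : x ∈ W) (hy : y ∈ W) : M.toBilin' x y = 0 := by
  have h := hW (x + y) (W.add_mem hx hy)
  have hx' := hW x hx
  have hy' := hW y hy
  rw [← Matrix.toBilin'_apply'] at h hx' hy'
  simp only [map_add, LinearMap.add_apply, hx', hy', toBilin'_comm hsym y x] at h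
  have : 2 * M.toBilin' x y = 0 := by linear_combination h
  exact (mul_eq_zero.mp this).resolve_left h2

lemma exists_toBilin'_eq (hns : M.det ≠ 0) {ι : Type*} {w : ι → Fin 4 → F}
    (hw : LinearIndependent F w) (t : ι → F) : ∃ x, ∀ i, M.toBilin' x (w i) = t i := by
  obtain ⟨g, hg⟩ := LinearMap.exists_extend
    ((Finsupp.linearCombination F t).comp hw.repr)
  have hB : M.toBilin'.Nondegenerate :=
    LinearMap.BilinForm.nondegenerate_toBilin'_of_det_ne_zero' M hns
  refine ⟨(M.toBilin'.toDual hB).symm g, fun i => ?_⟩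
  rw [LinearMap.BilinForm.apply_toDual_symm_apply]
  have := LinearMap.congr_fun hg ⟨w i, Submodule.subset_span ⟨i, rfl⟩⟩
  simpa [hw.repr_eq_single i ⟨w i, Submodule.subset_span ⟨i, rfl⟩⟩ rfl] using this

lemma exists_isDualFrame (hns : M.det ≠ 0) {u v : Fin 4 → F}
    (huv : LinearIndependent F ![u, v]) (huu : M.toBilin' u u = 0) (huv0 : M.toBilin' u v = 0)
    (hvv : M.toBilin' v v = 0) : ∃ x y, IsDualFrame M (Matrix.of ![x, y, u, v]) := by
  obtain ⟨x, hx⟩ := exists_toBilin'_eq hns huv ![1, 0]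
  obtain ⟨y, hy⟩ := exists_toBilin'_eq hns huv ![0, 1]
  exact ⟨x, y, hx 0, hx 1, hy 0, hy 1, huu, huv0, hvv⟩

lemma exists_basis_pair {W : Submodule F (Fin 4 → F)} (hW : Module.finrank F W = 2) :
    ∃ u ∈ W, ∃ v ∈ W, LinearIndependent F ![u, v] := by
  let b := Module.finBasisOfFinrankEq F W hW
  refine ⟨b 0, (b 0).2, b 1, (b 1).2, ?_⟩
  have h : ![(b 0 : Fin 4 → F), b 1] = W.subtype ∘ b := by
    ext i : 1
    fin_cases i <;> rfl
  rw [h]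
  exact b.linearIndependent.map' W.subtype (Submodule.ker_subtype W)

lemma exists_isDualFrame_of_isotropic (h2 : (2 : F) ≠ 0) (hsym : M.IsSymm) (hns : M.det ≠ 0)
    {W : Submodule F (Fin 4 → F)} (hW2 : Module.finrank F W = 2)
    (hW : ∀ x ∈ W, x ⬝ᵥ M *ᵥ x = 0) : ∃ A, IsDualFrame M A ∧ A 2 ∈ W ∧ A 3 ∈ W := by
  obtain ⟨u, hu, v, hv, huv⟩ := exists_basis_pair hW2
  obtain ⟨x, y, h⟩ := exists_isDualFrame hns huv
    (toBilin'_eq_zero_of_isotropic h2 hsym hW hu hu)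
    (toBilin'_eq_zero_of_isotropic h2 hsym hW hu hv)
    (toBilin'_eq_zero_of_isotropic h2 hsym hW hv hv)
  exact ⟨_, h, hu, hv⟩

lemma ruling_union (h2 : (2 : F) ≠ 0) (hsym : M.IsSymm) {δ : F} (hδ : δ ^ 2 = M.det)
    (hns : M.det ≠ 0) :
    ruling M δ ∪ ruling M (-δ) =
      {W : Submodule F (Fin 4 → F) | Module.finrank F W = 2 ∧ ∀ x ∈ W, x ⬝ᵥ M *ᵥ x = 0} := by
  ext W
  constructor
  · rintro (h | h) <;> exact ⟨h.1, h.2.1⟩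
  · rintro ⟨hW2, hW⟩
    obtain ⟨A, hA, hA2, hA3⟩ := exists_isDualFrame_of_isotropic h2 hsym hns hW2 hW
    have hdet : ∀ A', IsDualFrame M A' → A' 2 ∈ W → A' 3 ∈ W → A'.det = A.det :=
      fun A' hA' h2' h3' => hA.det_eq hsym hA'
        (toBilin'_eq_zero_of_isotropic h2 hsym hW h2' hA2)
        (toBilin'_eq_zero_of_isotropic h2 hsym hW h2' hA3)
        (toBilin'_eq_zero_of_isotropic h2 hsym hW h3' hA2)
        (toBilin'_eq_zero_of_isotropic h2 hsym hW h3' hA3)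
    have hsq : (δ * A.det) ^ 2 = 1 := by
      rw [mul_pow, hδ, mul_comm, hA.det_sq hsym]
    rcases mul_self_eq_one_iff.mp ((sq _).symm.trans hsq) with h | h
    · exact Or.inl ⟨hW2, hW, fun A' hA' h2' h3' => by rw [hdet A' hA' h2' h3', h]⟩
    · exact Or.inr ⟨hW2, hW, fun A' hA' h2' h3' => by
        rw [hdet A' hA' h2' h3', neg_mul, h, neg_neg]⟩

lemma inf_ne_bot_of_mem_ruling (h2 : (2 : F) ≠ 0) (hsym : M.IsSymm) (hns : M.det ≠ 0)
    {ε ε' : F} (hε : ε ≠ ε') {L L' : Submodule F (Fin 4 → F)} (hL : L ∈ ruling M ε)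
    (hL' : L' ∈ ruling M ε') : L ⊓ L' ≠ ⊥ := by
  intro hbot
  have htop : L ⊔ L' = ⊤ := Submodule.eq_top_of_disjoint L L'
    (by simp [hL.1, hL'.1]) (disjoint_iff.mpr hbot)
  obtain ⟨A, hA, hA2, hA3⟩ := exists_isDualFrame_of_isotropic h2 hsym hns hL.1 hL.2.1
  have hdual : ∀ z, ∃ z' ∈ L', ∀ w ∈ L, M.toBilin' z' w = M.toBilin' z w := fun z => by
    obtain ⟨l, hl, z', hz', rfl⟩ := Submodule.mem_sup.mp (htop ▸ Submodule.mem_top : z ∈ L ⊔ L')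
    refine ⟨z', hz', fun w hw => ?_⟩
    simp [toBilin'_eq_zero_of_isotropic h2 hsym hL.2.1 hl hw]
  obtain ⟨x, hx, hx'⟩ := hdual (A 0)
  obtain ⟨y, hy, hy'⟩ := hdual (A 1)
  have h1 := hL.2.2 (Matrix.of ![x, y, A 2, A 3])
    ⟨(hx' _ hA2).trans hA.h02, (hx' _ hA3).trans hA.h03, (hy' _ hA2).trans hA.h12,
      (hy' _ hA3).trans hA.h13, hA.h22, hA.h23, hA.h33⟩ hA2 hA3
  have h2' := hL'.2.2 (Matrix.of ![A 2, A 3, x, y])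
    ⟨(toBilin'_comm hsym _ _).trans ((hx' _ hA2).trans hA.h02),
      (toBilin'_comm hsym _ _).trans ((hy' _ hA2).trans hA.h12),
      (toBilin'_comm hsym _ _).trans ((hx' _ hA3).trans hA.h03),
      (toBilin'_comm hsym _ _).trans ((hy' _ hA3).trans hA.h13),
      toBilin'_eq_zero_of_isotropic h2 hsym hL'.2.1 hx hx,
      toBilin'_eq_zero_of_isotropic h2 hsym hL'.2.1 hx hy,
      toBilin'_eq_zero_of_isotropic h2 hsym hL'.2.1 hy hy⟩ hx hy
  have hdet : (Matrix.of ![A 2, A 3, x, y]).det = (Matrix.of ![x, y, A 2, A 3]).det := by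
    simp only [Matrix.det_succ_row_zero (n := 3), Fin.sum_univ_succ, Matrix.det_fin_three]
    simp [Fin.succAbove]
    ring
  rw [hdet] at h2'
  exact hε (mul_right_cancel₀ (right_ne_zero_of_mul_eq_one h1) (h1.trans h2'.symm))

lemma eq_or_inf_eq_bot_of_mem_ruling (h2 : (2 : F) ≠ 0) (hsym : M.IsSymm) (hns : M.det ≠ 0)
    {ε : F} {L L' : Submodule F (Fin 4 → F)} (hL : L ∈ ruling M ε) (hL' : L' ∈ ruling M ε) :
    L = L' ∨ L ⊓ L' = ⊥ := by
  by_contra! hcon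
  obtain ⟨hne, hbot⟩ := hcon
  obtain ⟨u, ⟨hu, hu'⟩, hu0⟩ := Submodule.exists_mem_ne_zero_of_ne_bot hbot
  obtain ⟨w, hw, hwL⟩ : ∃ w ∈ L', w ∉ L := by
    by_contra! h
    exact hne (Submodule.eq_of_le_of_finrank_eq h (hL'.1.trans hL.1.symm)).symm
  obtain ⟨v, hv, hvL⟩ : ∃ v ∈ L, v ∉ L' := by
    by_contra! h
    exact hne (Submodule.eq_of_le_of_finrank_eq h (hL.1.trans hL'.1.symm))
  have iso := fun {x y} => toBilin'_eq_zero_of_isotropic h2 hsym hL.2.1 (x := x) (y := y)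
  have iso' := fun {x y} => toBilin'_eq_zero_of_isotropic h2 hsym hL'.2.1 (x := x) (y := y)
  have hind : LinearIndependent F ![u, v] := by
    refine (LinearIndependent.pair_iff' hu0).mpr fun a ha => hvL ?_
    rw [← ha]
    exact L'.smul_mem a hu'
  obtain ⟨x, y, hA⟩ := exists_isDualFrame hns hind (iso hu hu) (iso hu hv) (iso hv hv)
  obtain ⟨c, -, hc, hc0, hc1⟩ := hA.exists_coeff hsym w
  have hc0' : c 0 = 0 := by rw [← hc0]; exact iso' hw hu'
  have hc1' : c 1 ≠ 0 := fun h => hwL <| by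
    rw [hc, hc0', h, zero_smul, zero_smul, zero_add, zero_add]
    exact L.add_mem (L.smul_mem (c 2) hu) (L.smul_mem (c 3) hv)
  set w' := (c 1)⁻¹ • w with hw'
  have hw'L : w' ∈ L' := L'.smul_mem _ hw
  have hwv : M.toBilin' w' v = 1 := by
    change M.toBilin' w v = c 1 at hc1
    simp [hw', hc1, hc1']
  set x' := x - M.toBilin' x w' • v with hx'
  have hxu : M.toBilin' x' u = 1 := by
    have : M.toBilin' x u = 1 := hA.h02
    simp [hx', this, iso hv hu]
  have hxv : M.toBilin' x' v = 0 := by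
    have : M.toBilin' x v = 0 := hA.h03
    simp [hx', this, iso hv hv]
  have hxw : M.toBilin' x' w' = 0 := by
    simp [hx', toBilin'_comm hsym v w', hwv]
  have h1 := hL.2.2 (Matrix.of ![x', w', u, v])
    ⟨hxu, hxv, iso' hw'L hu', hwv, iso hu hu, iso hu hv, iso hv hv⟩ hu hv
  have h1' := hL'.2.2 (Matrix.of ![x', v, u, w'])
    ⟨hxu, hxw, iso hv hu, (toBilin'_comm hsym _ _).trans hwv, iso' hu' hu', iso' hu' hw'L,
      iso' hw'L hw'L⟩ hu' hw'L
  have hdet : (Matrix.of ![x', v, u, w']).det = -(Matrix.of ![x', w', u, v]).det := by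
    simp only [Matrix.det_succ_row_zero (n := 3), Fin.sum_univ_succ, Matrix.det_fin_three]
    simp [Fin.succAbove]
    ring
  rw [hdet] at h1'
  exact h2 (by linear_combination -h1 - h1')

lemma ruling_inter (h2 : (2 : F) ≠ 0) (hsym : M.IsSymm) (hns : M.det ≠ 0)
    {ε ε' : F} (hε : ε ≠ ε') : ruling M ε ∩ ruling M ε' = ∅ := by
  refine Set.eq_empty_of_forall_notMem fun W ⟨h, h'⟩ => hε ?_
  obtain ⟨A, hA, hA2, hA3⟩ := exists_isDualFrame_of_isotropic h2 hsym hns h.1 h.2.1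
  have h1 := h.2.2 A hA hA2 hA3
  exact mul_right_cancel₀ (right_ne_zero_of_mul_eq_one h1) (h1.trans (h'.2.2 A hA hA2 hA3).symm)

lemma span_pair_isotropic (hsym : M.IsSymm) {u v : Fin 4 → F}
    (huv : LinearIndependent F ![u, v]) (huu : M.toBilin' u u = 0) (huv0 : M.toBilin' u v = 0)
    (hvv : M.toBilin' v v = 0) :
    Module.finrank F (Submodule.span F {u, v}) = 2 ∧
      ∀ x ∈ Submodule.span F {u, v}, x ⬝ᵥ M *ᵥ x = 0 := by
  refine ⟨?_, fun x hx => ?_⟩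
  · rw [← Matrix.range_cons_cons_empty u v ![]]
    exact (finrank_span_eq_card huv).trans (Fintype.card_fin 2)
  obtain ⟨a, b, rfl⟩ := Submodule.mem_span_pair.mp hx
  rw [← Matrix.toBilin'_apply']
  simp [huu, huv0, hvv, toBilin'_comm hsym v u]

lemma exists_orthogonal_basis_toBilin' (h2 : (2 : F) ≠ 0) (hsym : M.IsSymm) (hns : M.det ≠ 0) :
    ∃ e : Module.Basis (Fin 4) F (Fin 4 → F), (∀ i j, i ≠ j → M.toBilin' (e i) (e j) = 0) ∧
      ∀ i, M.toBilin' (e i) (e i) ≠ 0 := by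
  have := invertibleOfNonzero h2
  obtain ⟨b, hb⟩ := LinearMap.BilinForm.exists_orthogonal_basis
    (LinearMap.BilinForm.isSymm_iff.mp (Matrix.isSymm_toBilin'_iff_isSymm.mpr hsym))
  have hB : M.toBilin'.Nondegenerate :=
    LinearMap.BilinForm.nondegenerate_toBilin'_of_det_ne_zero' M hns
  have hcard : Module.finrank F (Fin 4 → F) = 4 := by simp
  refine ⟨b.reindex (finCongr hcard), fun i j hij => ?_, fun i => ?_⟩
  · simpa using hb (fun h => hij (by simpa using h))
  · simpa using hb.not_isOrtho_basis_self_of_separatingLeft hB.1 _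

lemma exists_isotropic_planes [IsAlgClosed F] (h2 : (2 : F) ≠ 0) (hsym : M.IsSymm)
    (hns : M.det ≠ 0) :
    ∃ W W' : Submodule F (Fin 4 → F),
      (Module.finrank F W = 2 ∧ ∀ x ∈ W, x ⬝ᵥ M *ᵥ x = 0) ∧
      (Module.finrank F W' = 2 ∧ ∀ x ∈ W', x ⬝ᵥ M *ᵥ x = 0) ∧ W ≠ W' ∧ W ⊓ W' ≠ ⊥ := by
  obtain ⟨e, he, hd⟩ := exists_orthogonal_basis_toBilin' h2 hsym hns
  obtain ⟨r, hr⟩ := IsAlgClosed.exists_pow_nat_eq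
    (-M.toBilin' (e 0) (e 0) / M.toBilin' (e 1) (e 1)) two_pos
  obtain ⟨s, hs⟩ := IsAlgClosed.exists_pow_nat_eq
    (-M.toBilin' (e 2) (e 2) / M.toBilin' (e 3) (e 3)) two_pos
  have hs0 : s ≠ 0 := by
    rintro rfl
    rw [zero_pow two_ne_zero] at hs
    exact div_ne_zero (neg_ne_zero.mpr (hd 2)) (hd 3) hs.symm
  rw [eq_div_iff (hd _)] at hr hs
  set u := e 0 + r • e 1 with hu
  have hind : ∀ t : F, LinearIndependent F ![u, e 2 + t • e 3] := fun t => by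
    refine LinearIndependent.pair_iff.mpr fun a b hab => ?_
    have h0 := congrArg (fun z => e.repr z 0) hab
    have h2 := congrArg (fun z => e.repr z 2) hab
    simp [hu] at h0 h2
    exact ⟨h0, h2⟩
  have huu : M.toBilin' u u = 0 := by
    simp [hu, he]
    linear_combination hr
  have huv : ∀ t : F, M.toBilin' u (e 2 + t • e 3) = 0 := fun t => by simp [hu, he]
  have hvv : ∀ t : F, t ^ 2 = s ^ 2 → M.toBilin' (e 2 + t • e 3) (e 2 + t • e 3) = 0 :=
    fun t ht => by
      simp [he]
      linear_combination hs + ht * M.toBilin' (e 3) (e 3)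
  have hW := span_pair_isotropic hsym (hind s) huu (huv s) (hvv s rfl)
  have hW' := span_pair_isotropic hsym (hind (-s)) huu (huv (-s)) (hvv (-s) (neg_sq s))
  refine ⟨_, _, hW, hW', fun heq => ?_, fun hbot => ?_⟩
  · have hmem : e 2 + -s • e 3 ∈ Submodule.span F {u, e 2 + s • e 3} :=
      heq ▸ Submodule.subset_span (by simp)
    have := toBilin'_eq_zero_of_isotropic h2 hsym hW.2 (Submodule.subset_span (by simp)) hmem
      (x := e 2 + s • e 3)
    simp [he] at this
    have h4 : 2 * M.toBilin' (e 2) (e 2) = 0 := by linear_combination this + hs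
    exact (mul_ne_zero h2 (hd 2)) h4
  · have hu0 : u ∈ (⊥ : Submodule F (Fin 4 → F)) :=
      hbot ▸ ⟨Submodule.subset_span (by simp), Submodule.subset_span (by simp)⟩
    exact (hind s).ne_zero 0 ((Submodule.mem_bot F).mp hu0)

lemma ruling_nonempty [IsAlgClosed F] (h2 : (2 : F) ≠ 0) (hsym : M.IsSymm)
    (hns : M.det ≠ 0) {δ : F} (hδ : δ ^ 2 = M.det) :
    (ruling M δ).Nonempty ∧ (ruling M (-δ)).Nonempty := by
  obtain ⟨W, W', hW, hW', hne, hinf⟩ := exists_isotropic_planes h2 hsym hns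
  have hunion := ruling_union h2 hsym hδ hns
  have h1 : W ∈ ruling M δ ∪ ruling M (-δ) := hunion ▸ hW
  have h1' : W' ∈ ruling M δ ∪ ruling M (-δ) := hunion ▸ hW'
  have key : ∀ ε, ¬ (W ∈ ruling M ε ∧ W' ∈ ruling M ε) := fun ε h =>
    (eq_or_inf_eq_bot_of_mem_ruling h2 hsym hns h.1 h.2).elim hne hinf
  rcases h1 with h | h <;> rcases h1' with h' | h'
  · exact (key _ ⟨h, h'⟩).elim
  · exact ⟨⟨W, h⟩, ⟨W', h'⟩⟩
  · exact ⟨⟨W', h'⟩, ⟨W, h⟩⟩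
  · exact (key _ ⟨h, h'⟩).elim

end Rulings

section Galois

lemma toBilin'_map {R S : Type*} [CommRing R] [CommRing S] (f : R →+* S)
    (M : Matrix (Fin 4) (Fin 4) R) (x y : Fin 4 → R) :
    (M.map f).toBilin' (f ∘ x) (f ∘ y) = f (M.toBilin' x y) := by
  rw [Matrix.toBilin'_apply', Matrix.toBilin'_apply', RingHom.map_dotProduct]
  congr 1
  ext i
  exact (RingHom.map_mulVec f M y i).symm

lemma IsDualFrame.map {F F' : Type*} [Field F] [Field F'] (f : F →+* F')
    {M A : Matrix (Fin 4) (Fin 4) F} (h : IsDualFrame M A) :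
    IsDualFrame (M.map f) (A.map f) := by
  have key : ∀ i j, (M.map f).toBilin' (A.map f i) (A.map f j) = f (M.toBilin' (A i) (A j)) :=
    fun i j => toBilin'_map f M (A i) (A j)
  constructor <;> rw [key]
  · rw [h.h02, map_one]
  · rw [h.h03, map_zero]
  · rw [h.h12, map_zero]
  · rw [h.h13, map_one]
  · rw [h.h22, map_zero]
  · rw [h.h23, map_zero]
  · rw [h.h33, map_zero]

variable {K : Type*} [Field K]

lemma mem_galActSub {σ : AlgebraicClosure K ≃ₐ[K] AlgebraicClosure K}
    {W : Submodule (AlgebraicClosure K) (Fin 4 → AlgebraicClosure K)}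
    {y : Fin 4 → AlgebraicClosure K} :
    y ∈ galActSub σ W ↔ ∃ x ∈ W, σ ∘ x = y := Iff.rfl

lemma mem_galActSub_iff_symm_comp_mem {σ : AlgebraicClosure K ≃ₐ[K] AlgebraicClosure K}
    {W : Submodule (AlgebraicClosure K) (Fin 4 → AlgebraicClosure K)}
    {y : Fin 4 → AlgebraicClosure K} :
    y ∈ galActSub σ W ↔ σ.symm ∘ y ∈ W := by
  rw [mem_galActSub]
  constructor
  · rintro ⟨x, hx, rfl⟩
    convert hx
    ext i
    simp
  · intro h
    refine ⟨_, h, ?_⟩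
    ext i
    simp

lemma galActSub_galActSub_symm (σ : AlgebraicClosure K ≃ₐ[K] AlgebraicClosure K)
    (W : Submodule (AlgebraicClosure K) (Fin 4 → AlgebraicClosure K)) :
    galActSub σ (galActSub σ.symm W) = W := by
  ext y
  rw [mem_galActSub_iff_symm_comp_mem, mem_galActSub_iff_symm_comp_mem]
  convert Iff.rfl
  ext i
  simp

lemma finrank_galActSub (σ : AlgebraicClosure K ≃ₐ[K] AlgebraicClosure K)
    (W : Submodule (AlgebraicClosure K) (Fin 4 → AlgebraicClosure K)) :
    Module.finrank (AlgebraicClosure K) (galActSub σ W) =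
      Module.finrank (AlgebraicClosure K) W := by
  let j : W →+ galActSub σ W :=
    { toFun := fun x => ⟨σ ∘ x.1, x.1, x.2, rfl⟩
      map_zero' := by ext; simp
      map_add' := fun x y => by ext; simp }
  have hj : Function.Bijective j := by
    constructor
    · intro x y hxy
      ext i
      exact σ.injective (congrFun (congrArg Subtype.val hxy) i)
    · rintro ⟨_, x, hx, rfl⟩
      exact ⟨⟨x, hx⟩, rfl⟩
  refine (congrArg Cardinal.toNat (rank_eq_of_equiv_equiv σ (AddEquiv.ofBijective j hj)
    σ.bijective fun r m => ?_)).symm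
  ext i
  exact map_mul σ r (m.1 i)

lemma map_algebraMap_map (σ : AlgebraicClosure K ≃ₐ[K] AlgebraicClosure K)
    (M : Matrix (Fin 4) (Fin 4) K) :
    (M.map (algebraMap K (AlgebraicClosure K))).map
      (σ : AlgebraicClosure K →+* AlgebraicClosure K) =
      M.map (algebraMap K (AlgebraicClosure K)) := by
  ext i j
  simp

lemma galActSub_mem_ruling (σ : AlgebraicClosure K ≃ₐ[K] AlgebraicClosure K)
    (M : Matrix (Fin 4) (Fin 4) K) {ε : AlgebraicClosure K}
    {W : Submodule (AlgebraicClosure K) (Fin 4 → AlgebraicClosure K)}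
    (hW : W ∈ ruling (M.map (algebraMap K (AlgebraicClosure K))) ε) :
    galActSub σ W ∈ ruling (M.map (algebraMap K (AlgebraicClosure K))) (σ ε) := by
  refine ⟨(finrank_galActSub σ W).trans hW.1, ?_, fun A hA hA2 hA3 => ?_⟩
  · rintro _ ⟨x, hx, rfl⟩
    have h := toBilin'_map (σ : AlgebraicClosure K →+* AlgebraicClosure K)
      (M.map (algebraMap K (AlgebraicClosure K))) x x
    rw [map_algebraMap_map, Matrix.toBilin'_apply', Matrix.toBilin'_apply', hW.2.1 x hx,
      map_zero] at h
    exact h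
  · have hA' := hA.map (σ.symm : AlgebraicClosure K →+* AlgebraicClosure K)
    rw [map_algebraMap_map] at hA'
    have h := congrArg σ (hW.2.2 _ hA' (mem_galActSub_iff_symm_comp_mem.mp hA2)
      (mem_galActSub_iff_symm_comp_mem.mp hA3))
    have hdet : (A.map (σ.symm : AlgebraicClosure K →+* AlgebraicClosure K)).det =
        σ.symm A.det := (RingHom.map_det _ A).symm
    rwa [hdet, map_mul, map_one, AlgEquiv.apply_symm_apply] at h

lemma galActSub_image_ruling (σ : AlgebraicClosure K ≃ₐ[K] AlgebraicClosure K)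
    (M : Matrix (Fin 4) (Fin 4) K) (ε : AlgebraicClosure K) :
    galActSub σ '' ruling (M.map (algebraMap K (AlgebraicClosure K))) ε =
      ruling (M.map (algebraMap K (AlgebraicClosure K))) (σ ε) := by
  refine Set.Subset.antisymm ?_ fun W hW => ?_
  · rintro _ ⟨W, hW, rfl⟩
    exact galActSub_mem_ruling σ M hW
  · refine ⟨galActSub σ.symm W, ?_, galActSub_galActSub_symm σ W⟩
    simpa using galActSub_mem_ruling σ.symm M hW

open Polynomial in
lemma exists_algEquiv_eq_neg {L : Type*} [Field L] [Algebra K L] [Normal K L] {d : K}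
    (hd : ¬ IsSquare d) {δ : L} (hδ : δ ^ 2 = algebraMap K L d) :
    ∃ σ : L ≃ₐ[K] L, σ δ = -δ := by
  have hirr : Irreducible (X ^ 2 - C d) :=
    X_pow_sub_C_irreducible_of_prime Nat.prime_two fun b hb => hd ⟨b, by rw [← hb, sq]⟩
  have hmin : ∀ x : L, x ^ 2 = algebraMap K L d → X ^ 2 - C d = minpoly K x := fun x hx =>
    minpoly.eq_of_irreducible_of_monic hirr (by simp [hx]) (monic_X_pow_sub_C d two_ne_zero)
  exact isConjRoot_iff_exists_algEquiv.mp
    ((hmin (-δ) (by rw [neg_sq, hδ])).symm.trans (hmin δ hδ))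

end Galois

/-- Let `K` be a field of characteristic ≠ 2 and `M` a symmetric invertible 4×4
matrix over `K`, defining the nonsingular quadric `Q : xᵀMx = 0` in `P³`.  The lines of `P³`
over the algebraic closure `K̄` lying on `Q` (2-dimensional subspaces of `K̄⁴` on which the
quadratic form vanishes) fall into exactly two rulings `R₁, R₂`: two nonempty disjoint
classes covering all lines, such that two distinct lines in the same ruling are disjoint
while lines in opposite rulings meet.  Each ruling is individually stable under the Galois
group `Gal(K̄/K)` (i.e. defined over `K`) if and only if `det M` is a square in `K`; otherwise
the two rulings are interchanged by some element of the Galois group (quadratic conjugate). -/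
theorem rulings_defined_over_K_iff_det_isSquare
    (K : Type*) [Field K] (hchar : (2 : K) ≠ 0)
    (M : Matrix (Fin 4) (Fin 4) K) (hsym : M.IsSymm) (hns : IsUnit M.det) :
    ∃ R₁ R₂ : Set (Submodule (AlgebraicClosure K) (Fin 4 → AlgebraicClosure K)),
      (R₁ ∪ R₂ = {W : Submodule (AlgebraicClosure K) (Fin 4 → AlgebraicClosure K) | Module.finrank (AlgebraicClosure K) ↥W = 2 ∧ ∀ x ∈ W,
          dotProduct x ((M.map (algebraMap K (AlgebraicClosure K))).mulVec x) = 0}) ∧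
      R₁ ∩ R₂ = ∅ ∧ R₁.Nonempty ∧ R₂.Nonempty ∧
      (∀ L ∈ R₁, ∀ L' ∈ R₁, L = L' ∨ L ⊓ L' = ⊥) ∧
      (∀ L ∈ R₂, ∀ L' ∈ R₂, L = L' ∨ L ⊓ L' = ⊥) ∧
      (∀ L ∈ R₁, ∀ L' ∈ R₂, L ⊓ L' ≠ ⊥) ∧
      ((∀ σ : AlgebraicClosure K ≃ₐ[K] AlgebraicClosure K,
          galActSub σ '' R₁ = R₁ ∧ galActSub σ '' R₂ = R₂) ↔ IsSquare M.det) ∧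
      (¬ IsSquare M.det →
        ∃ σ : AlgebraicClosure K ≃ₐ[K] AlgebraicClosure K,
          galActSub σ '' R₁ = R₂ ∧ galActSub σ '' R₂ = R₁) := by
  obtain ⟨δ, hδ⟩ := IsAlgClosed.exists_pow_nat_eq
    (algebraMap K (AlgebraicClosure K) M.det) two_pos
  set N := M.map (algebraMap K (AlgebraicClosure K)) with hN
  have hdet : algebraMap K (AlgebraicClosure K) M.det = N.det := RingHom.map_det _ M
  have h2 : (2 : AlgebraicClosure K) ≠ 0 := by
    rw [← map_ofNat (algebraMap K (AlgebraicClosure K)) 2]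
    exact (map_ne_zero _).mpr hchar
  have hsymN : N.IsSymm := hsym.map _
  have hnsN : N.det ≠ 0 := hdet ▸ (map_ne_zero _).mpr hns.ne_zero
  have hδN : δ ^ 2 = N.det := hδ.trans hdet
  have hδ0 : δ ≠ 0 := by
    rintro rfl
    exact hnsN (by rw [← hδN]; simp)
  have hne : δ ≠ -δ := fun h => mul_ne_zero h2 hδ0 (by linear_combination h)
  have hnonempty := ruling_nonempty h2 hsymN hnsN hδN
  have hinter := ruling_inter h2 hsymN hnsN hne
  have hswap : ¬ IsSquare M.det → ∃ σ : AlgebraicClosure K ≃ₐ[K] AlgebraicClosure K,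
      galActSub σ '' ruling N δ = ruling N (-δ) ∧ galActSub σ '' ruling N (-δ) = ruling N δ := by
    intro hsq
    obtain ⟨σ, hσ⟩ := exists_algEquiv_eq_neg hsq hδ
    exact ⟨σ, by rw [galActSub_image_ruling, hσ],
      by rw [galActSub_image_ruling, map_neg, hσ, neg_neg]⟩
  refine ⟨ruling N δ, ruling N (-δ), ruling_union h2 hsymN hδN hnsN, hinter, hnonempty.1,
    hnonempty.2, fun L hL L' hL' => eq_or_inf_eq_bot_of_mem_ruling h2 hsymN hnsN hL hL',
    fun L hL L' hL' => eq_or_inf_eq_bot_of_mem_ruling h2 hsymN hnsN hL hL',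
    fun L hL L' hL' => inf_ne_bot_of_mem_ruling h2 hsymN hnsN hne hL hL', ⟨fun h => ?_, ?_⟩, hswap⟩
  · by_contra hsq
    obtain ⟨σ, hσ, -⟩ := hswap hsq
    obtain ⟨W, hW⟩ := hnonempty.1
    have hW' : W ∈ ruling N (-δ) := by rwa [← hσ, (h σ).1]
    exact Set.notMem_empty W (hinter ▸ ⟨hW, hW'⟩)
  · rintro ⟨d, hd⟩ σ
    have hσ : σ δ = δ := by
      have : δ ^ 2 = algebraMap K (AlgebraicClosure K) d ^ 2 := by rw [hδ, hd, map_mul, sq]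
      rcases sq_eq_sq_iff_eq_or_eq_neg.mp this with h | h <;> simp [h]
    exact ⟨by rw [galActSub_image_ruling, hσ], by rw [galActSub_image_ruling, map_neg, hσ]⟩
end

section
/- The plane quartic C : (v² + vw − w²)(uv + w²) = (u² − v² − w²)² has no ℚ-rational points. -/
theorem Int.even_even_odd_of_quartic {u v w : ℤ}
    (h : (v ^ 2 + v * w - w ^ 2) * (u * v + w ^ 2) = (u ^ 2 - v ^ 2 - w ^ 2) ^ 2)
    (hp : ∀ p : ℤ, Prime p → p ∣ u → p ∣ v → ¬ p ∣ w) : Even u ∧ Even v ∧ Odd w := by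
  have key : ∀ a b c : ZMod 2,
      (b ^ 2 + b * c - c ^ 2) * (a * b + c ^ 2) = (a ^ 2 - b ^ 2 - c ^ 2) ^ 2 →
      a = 0 ∧ b = 0 := by decide
  have h2 := congrArg (Int.cast : ℤ → ZMod 2) h
  push_cast at h2
  obtain ⟨hu, hv⟩ := key _ _ _ h2
  rw [ZMod.intCast_eq_zero_iff_even] at hu hv
  refine ⟨hu, hv, ?_⟩
  rw [← Int.not_even_iff_odd]
  exact fun hw => hp 2 Int.prime_two hu.two_dvd hv.two_dvd hw.two_dvd

theorem IsCoprime.not_dvd_of_prime {a b p : ℤ} (h : IsCoprime a b) (hp : Prime p) (ha : p ∣ a) :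
    ¬ p ∣ b :=
  fun hb => hp.not_isUnit (h.isUnit_of_dvd' ha hb)

theorem jacobiSym_ne_neg_one_of_dvd {a x y : ℤ} {n : ℕ} (hx : IsCoprime x n)
    (h : (n : ℤ) ∣ y ^ 2 - a * x ^ 2) : jacobiSym a n ≠ -1 := by
  intro hJ
  refine ZMod.nonsquare_of_jacobiSym_eq_neg_one hJ ?_
  obtain ⟨b, c, hbc⟩ := hx
  have hb := congrArg (Int.cast : ℤ → ZMod n) hbc
  have hy := (ZMod.intCast_zmod_eq_zero_iff_dvd _ _).2 h
  push_cast at hb hy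
  rw [ZMod.natCast_self, mul_zero, add_zero] at hb
  refine ⟨b * y, ?_⟩
  linear_combination (-(b : ZMod n) ^ 2) * hy - (a : ZMod n) * (b * x + 1) * hb

theorem mod_four_of_jacobiSym_neg_one {n : ℕ} (hn : Odd n) (h : jacobiSym (-1) n ≠ -1) :
    n % 4 = 1 := by
  rw [jacobiSym.mod_right _ hn] at h
  obtain ⟨k, rfl⟩ := hn
  have : (2 * k + 1) % 4 = 1 ∨ (2 * k + 1) % 4 = 3 := by omega
  refine this.resolve_right fun h3 => h ?_
  norm_num [h3]

theorem mod_three_of_jacobiSym_three {n : ℕ} (hn : n % 4 = 1) (hn3 : n % 3 ≠ 0)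
    (h : jacobiSym 3 n ≠ -1) : n % 3 = 1 := by
  rw [jacobiSym.mod_right _ (Nat.odd_iff.2 (by omega))] at h
  have : n % 12 = 5 ∨ n % 3 = 1 := by omega
  refine this.resolve_left fun h5 => h ?_
  norm_num [h5]

theorem mod_five_of_jacobiSym_neg_fifteen {n : ℕ} (hn : Odd n) (hn3 : n % 3 = 1)
    (hn5 : n % 5 ≠ 0) (h : jacobiSym (-15) n ≠ -1) : n % 5 = 1 ∨ n % 5 = 4 := by
  rw [jacobiSym.mod_right _ hn] at h
  rw [Nat.odd_iff] at hn
  by_contra hcon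
  have : n % 60 = 7 ∨ n % 60 = 13 ∨ n % 60 = 37 ∨ n % 60 = 43 := by
    have : n % 5 = 2 ∨ n % 5 = 3 := by omega
    rcases this with h5 | h5 <;> omega
  rcases this with h' | h' | h' | h' <;> exact h (by norm_num [h'])

/-- Coprime `v`, `w` and integers `r`, `s` with `v² + vw − w² = r²`, `uv + w² = s²` and
`u² − v² − w² = rs`, where `u` and `v` are even and `w` is odd. -/
structure QuarticCover (u v w r s : ℤ) : Prop where
  eq_left : v ^ 2 + v * w - w ^ 2 = r ^ 2
  eq_right : u * v + w ^ 2 = s ^ 2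
  eq_mul : u ^ 2 - v ^ 2 - w ^ 2 = r * s
  coprime : IsCoprime v w
  even_u : Even u
  even_v : Even v
  odd_w : Odd w

namespace QuarticCover

variable {u v w r s : ℤ}

theorem neg (h : QuarticCover u v w r s) : QuarticCover (-u) (-v) (-w) r s where
  eq_left := by linear_combination h.eq_left
  eq_right := by linear_combination h.eq_right
  eq_mul := by linear_combination h.eq_mul
  coprime := h.coprime.neg_neg
  even_u := h.even_u.neg
  even_v := h.even_v.neg
  odd_w := h.odd_w.neg

theorem odd_r (h : QuarticCover u v w r s) : Odd r := by
  have : Odd (r ^ 2) := by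
    rw [← h.eq_left]
    exact ((h.even_v.pow_of_ne_zero two_ne_zero).add (h.even_v.mul_right w)).sub_odd h.odd_w.pow
  exact Int.odd_pow' two_ne_zero |>.1 this

theorem mod_three (h : QuarticCover u v w r s) :
    (u : ZMod 3) = 0 ∧ (v : ZMod 3) = w ∧ (r : ZMod 3) = s ∧ (w : ZMod 3) ≠ 0 := by
  have key : ∀ b c r a s : ZMod 3, ¬ (b = 0 ∧ c = 0) → b ^ 2 + b * c - c ^ 2 = r ^ 2 →
      a * b + c ^ 2 = s ^ 2 → a ^ 2 - b ^ 2 - c ^ 2 = r * s → a = 0 ∧ b = c ∧ r = s ∧ c ≠ 0 := by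
    decide
  have h1 := congrArg (Int.cast : ℤ → ZMod 3) h.eq_left
  have h2 := congrArg (Int.cast : ℤ → ZMod 3) h.eq_right
  have h3 := congrArg (Int.cast : ℤ → ZMod 3) h.eq_mul
  push_cast at h1 h2 h3
  refine key _ _ _ _ _ ?_ h1 h2 h3
  intro hvw
  rw [ZMod.intCast_zmod_eq_zero_iff_dvd, ZMod.intCast_zmod_eq_zero_iff_dvd] at hvw
  exact h.coprime.not_dvd_of_prime Int.prime_three hvw.1 hvw.2

theorem isCoprime_v_add (h : QuarticCover u v w r s) : IsCoprime v (u + w) := by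
  refine isCoprime_of_prime_dvd ?_ ?_
  · rintro ⟨hv, hw⟩
    have := h.even_u
    have := h.odd_w
    grind
  · rintro p hp ⟨k, hk⟩ ⟨m, hm⟩
    have hrs : p ∣ r * s :=
      ⟨m * (u - w) - k * v, by linear_combination -h.eq_mul + (u - w) * hm - v * hk⟩
    have hw : p ∣ w ^ 2 := by
      rcases hp.dvd_or_dvd hrs with ⟨c, hc⟩ | ⟨c, hc⟩
      · exact ⟨k * (v + w) - c * r,
          by linear_combination -h.eq_left + (v + w) * hk - r * hc⟩
      · exact ⟨c * s - u * k, by linear_combination h.eq_right + s * hc - u * hk⟩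
    exact h.coprime.not_dvd_of_prime hp ⟨k, hk⟩ (hp.dvd_of_dvd_pow hw)

theorem w_mod_three (h : QuarticCover u v w r s) (hpos : 0 < u + w) : w % 3 = 1 := by
  obtain ⟨hu3, -, -, hw3⟩ := h.mod_three
  rw [ZMod.intCast_zmod_eq_zero_iff_dvd] at hu3
  rw [Ne, ZMod.intCast_zmod_eq_zero_iff_dvd] at hw3
  have hodd : Odd (u + w) := h.even_u.add_odd h.odd_w
  obtain ⟨n, hn⟩ := Int.eq_ofNat_of_zero_le hpos.le
  have hco : IsCoprime v (n : ℤ) := hn ▸ h.isCoprime_v_add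
  have hnodd : Odd n := by rwa [hn, Int.odd_coe_nat] at hodd
  have h4 : n % 4 = 1 := by
    refine mod_four_of_jacobiSym_neg_one hnodd
      (jacobiSym_ne_neg_one_of_dvd (y := r + s) hco ⟨2 * u - 2 * w + v, ?_⟩)
    rw [← hn]
    linear_combination -h.eq_left - h.eq_right - 2 * h.eq_mul
  have h3 : n % 3 = 1 := by
    refine mod_three_of_jacobiSym_three h4 (by omega)
      (jacobiSym_ne_neg_one_of_dvd (y := r - s) hco ⟨v + 2 * w - 2 * u, ?_⟩)
    rw [← hn]
    linear_combination -h.eq_left - h.eq_right + 2 * h.eq_mul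
  omega

theorem two_mul_add_pos (h : QuarticCover u v w r s) (hpos : 0 < u + w) : 0 < 2 * u + v := by
  by_contra! hneg
  have h1 : 0 ≤ 2 * u - 2 * w + v := by
    refine nonneg_of_mul_nonneg_right ?_ hpos
    nlinarith [sq_nonneg v, sq_nonneg (r + s), h.eq_left, h.eq_right, h.eq_mul]
  have hw : w ≤ 0 := by linarith
  have hw0 : w ≠ 0 := by
    rintro rfl
    simpa using h.odd_w
  nlinarith [sq_nonneg s, h.eq_right, mul_nonneg (by linarith : 0 ≤ u) (sub_nonneg.2 hneg),
    mul_pos hpos (by omega : 0 < u - w), sq_pos_of_ne_zero hw0]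

theorem not_five_dvd_r (h : QuarticCover u v w r s) : ¬ (5 : ℤ) ∣ r := by
  have h5 : Prime (5 : ℤ) := by norm_num
  rintro ⟨k, hk⟩
  have h0 : (2 * v + w) ^ 2 = 5 * (w ^ 2 + 20 * k ^ 2) := by
    subst hk
    linear_combination 4 * h.eq_left
  obtain ⟨m, hm⟩ := h5.dvd_of_dvd_pow ⟨_, h0⟩
  have hw : (5 : ℤ) ∣ w :=
    h5.dvd_of_dvd_pow (n := 2) ⟨m ^ 2 - 4 * k ^ 2, by
      have : 5 * w ^ 2 = 5 * (5 * (m ^ 2 - 4 * k ^ 2)) := by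
        linear_combination -h0 + (2 * v + w + 5 * m) * hm
      linarith⟩
  exact h.coprime.not_dvd_of_prime h5 (by omega) hw

theorem isCoprime_factors (h : QuarticCover u v w r s) :
    IsCoprime (2 * v + w - 2 * r) (2 * v + w + 2 * r) := by
  obtain ⟨k, hk⟩ := h.odd_w
  refine isCoprime_of_prime_dvd (by omega) fun p hp hA hB => ?_
  have hp2 : ¬ p ∣ 2 :=
    IsCoprime.not_dvd_of_prime ⟨1, r - v - k, by linear_combination hk⟩ hp hA
  have h2 : ∀ x, p ∣ 2 * x → p ∣ x := fun x hx => (hp.dvd_or_dvd hx).resolve_left hp2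
  have hr : p ∣ r := h2 _ (h2 _ ((dvd_sub hB hA).trans (dvd_of_eq (by ring))))
  have hx : p ∣ 2 * v + w := h2 _ ((dvd_add hA hB).trans (dvd_of_eq (by ring)))
  have hw : p ∣ 5 * w ^ 2 := by
    obtain ⟨a, ha⟩ := hA
    exact ⟨a * (2 * v + w + 2 * r), by
      linear_combination (2 * v + w + 2 * r) * ha - 4 * h.eq_left⟩
  rcases hp.dvd_or_dvd hw with hp5 | hw
  · have h5 : Prime (5 : ℤ) := by norm_num
    exact h.not_five_dvd_r ((hp.associated_of_dvd h5 hp5).symm.dvd.trans hr)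
  · have hw := hp.dvd_of_dvd_pow hw
    exact h.coprime.not_dvd_of_prime hp (h2 v ((dvd_add_left hw).1 hx)) hw

theorem two_mul_v_add_w_mod_five (h : QuarticCover u v w r s) :
    (2 * v + w : ZMod 5) = 2 ∨ (2 * v + w : ZMod 5) = 3 := by
  have key : ∀ x r b : ZMod 5, r ≠ 0 → x - 2 * r = 0 → x + 2 * r = b ^ 2 ∨ x + 2 * r = -b ^ 2 →
      x = 2 ∨ x = 3 := by decide
  have aux : ∀ r : ℤ, ¬ (5 : ℤ) ∣ r → IsCoprime (2 * v + w - 2 * r) (2 * v + w + 2 * r) →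
      (2 * v + w - 2 * r) * (2 * v + w + 2 * r) = 5 * w ^ 2 → (5 : ℤ) ∣ 2 * v + w - 2 * r →
      (2 * v + w : ZMod 5) = 2 ∨ (2 * v + w : ZMod 5) = 3 := by
    intro r hr hco hmul hdvd
    have h0 := (ZMod.intCast_zmod_eq_zero_iff_dvd _ 5).2 hdvd
    rw [show (5 : ℤ) = (5 : ℕ) from rfl, ← ZMod.intCast_zmod_eq_zero_iff_dvd] at hr
    obtain ⟨a, ha⟩ := hdvd
    rw [ha] at hco hmul
    obtain ⟨b, hb⟩ := Int.sq_of_isCoprime (c := w) (IsCoprime.of_mul_left_right hco).symm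
      (by linarith)
    push_cast at h0
    refine key _ r b hr h0 (hb.imp (fun h => ?_) fun h => ?_)
    · exact_mod_cast congrArg (Int.cast : ℤ → ZMod 5) h
    · exact_mod_cast congrArg (Int.cast : ℤ → ZMod 5) h
  have hmul : (2 * v + w - 2 * r) * (2 * v + w + 2 * r) = 5 * w ^ 2 := by
    linear_combination 4 * h.eq_left
  have h5 : Prime (5 : ℤ) := by norm_num
  rcases h5.dvd_or_dvd ⟨_, hmul⟩ with hd | hd
  · exact aux r h.not_five_dvd_r h.isCoprime_factors hmul hd
  · refine aux (-r) (by simpa using h.not_five_dvd_r) ?_ ?_ ?_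
    · simpa [← sub_eq_add_neg] using h.isCoprime_factors.symm
    · linear_combination hmul
    · simpa using hd

theorem not_of_pos (h : QuarticCover u v w r s) (hpos : 0 < u + w) : False := by
  obtain ⟨hu3, hvw3, hrs3, -⟩ := h.mod_three
  have hw3 := h.w_mod_three hpos
  have hmul : (2 * u + v - r - 2 * s) * (2 * u + v + r + 2 * s) = 4 * v ^ 2 - v * w + w ^ 2 := by
    linear_combination h.eq_left + 4 * h.eq_right + 4 * h.eq_mul
  have hodd : Odd (2 * u + v - r - 2 * s) := by
    have := h.odd_r
    have := h.even_v
    grind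
  have hTpos : 0 < 2 * u + v - r - 2 * s := by
    have hsum := h.two_mul_add_pos hpos
    have hw0 : w ≠ 0 := by
      rintro rfl
      simp at hw3
    by_contra! hneg
    nlinarith [sq_nonneg (8 * v - w), sq_pos_of_ne_zero hw0]
  have hco : IsCoprime w (2 * u + v - r - 2 * s) := by
    refine isCoprime_of_prime_dvd (by omega) fun p hp hw hT => ?_
    have hp2 : ¬ p ∣ 2 := by
      obtain ⟨k, hk⟩ := hodd
      exact IsCoprime.not_dvd_of_prime ⟨1, -k, by linear_combination hk⟩ hp hT
    have hv : p ∣ 2 * (2 * (v ^ 2)) := by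
      obtain ⟨a, ha⟩ := hw
      obtain ⟨b, hb⟩ := hT
      exact ⟨b * (2 * u + v + r + 2 * s) + v * a - w * a, by
        linear_combination -hmul + (2 * u + v + r + 2 * s) * hb + (v - w) * ha⟩
    have hv := (hp.dvd_or_dvd ((hp.dvd_or_dvd hv).resolve_left hp2)).resolve_left hp2
    exact h.coprime.not_dvd_of_prime hp (hp.dvd_of_dvd_pow hv) hw
  have hT3 : (2 * u + v - r - 2 * s) % 3 = 1 := by
    rw [ZMod.intCast_zmod_eq_zero_iff_dvd] at hu3
    rw [ZMod.intCast_eq_intCast_iff_dvd_sub] at hvw3 hrs3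
    omega
  have key : ∀ b c r : ZMod 5, r ≠ 0 ∧ (2 * b + c = 2 ∨ 2 * b + c = 3) ∧
      b ^ 2 + b * c - c ^ 2 = r ^ 2 → ∀ a s : ZMod 5, a * b + c ^ 2 = s ^ 2 ∧
      a ^ 2 - b ^ 2 - c ^ 2 = r * s →
      2 * a + b - r - 2 * s = 2 ∨ 2 * a + b - r - 2 * s = 3 := by decide
  have h1 := congrArg (Int.cast : ℤ → ZMod 5) h.eq_left
  have h2 := congrArg (Int.cast : ℤ → ZMod 5) h.eq_right
  have h3 := congrArg (Int.cast : ℤ → ZMod 5) h.eq_mul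
  have hr := h.not_five_dvd_r
  rw [show (5 : ℤ) = (5 : ℕ) from rfl, ← ZMod.intCast_zmod_eq_zero_iff_dvd] at hr
  push_cast at h1 h2 h3
  have hT5 := key _ _ _ ⟨hr, h.two_mul_v_add_w_mod_five, h1⟩ _ _ ⟨h2, h3⟩
  replace hT5 : (2 * u + v - r - 2 * s) % 5 = 2 ∨ (2 * u + v - r - 2 * s) % 5 = 3 := by
    refine hT5.imp (fun h => ?_) fun h => ?_
    · exact (ZMod.intCast_eq_intCast_iff' _ 2 5).1 (by exact_mod_cast h)
    · exact (ZMod.intCast_eq_intCast_iff' _ 3 5).1 (by exact_mod_cast h)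
  obtain ⟨n, hn⟩ := Int.eq_ofNat_of_zero_le hTpos.le
  have hmod := mod_five_of_jacobiSym_neg_fifteen (n := n) (by rwa [hn, Int.odd_coe_nat] at hodd)
    (by omega) (by omega) (jacobiSym_ne_neg_one_of_dvd (y := 8 * v - w) (hn ▸ hco)
      ⟨16 * (2 * u + v + r + 2 * s), by rw [← hn]; linear_combination -16 * hmul⟩)
  omega

end QuarticCover

theorem not_quarticCover (u v w r s : ℤ) : ¬ QuarticCover u v w r s := by
  intro h
  rcases lt_trichotomy (u + w) 0 with hlt | heq | hgt
  · exact h.neg.not_of_pos (by linarith)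
  · have := h.even_u
    have := h.odd_w
    grind
  · exact h.not_of_pos hgt

/-- The quartic equation has no primitive integer solution. -/
theorem Int.quartic_ne_of_primitive {u v w : ℤ}
    (hp : ∀ p : ℤ, Prime p → p ∣ u → p ∣ v → ¬ p ∣ w) :
    (v ^ 2 + v * w - w ^ 2) * (u * v + w ^ 2) ≠ (u ^ 2 - v ^ 2 - w ^ 2) ^ 2 := by
  intro h
  obtain ⟨hu, hv, hw⟩ := Int.even_even_odd_of_quartic h hp
  have hvw : IsCoprime v w := by
    refine isCoprime_of_prime_dvd ?_ fun p hpp hpv hpw => ?_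
    · rintro ⟨-, rfl⟩
      simp at hw
    · refine hp p hpp ?_ hpv hpw
      obtain ⟨a, ha⟩ := hpv
      obtain ⟨b, hb⟩ := hpw
      have : p ∣ (u ^ 2 - v ^ 2 - w ^ 2) ^ 2 := by
        rw [← h, ha, hb]
        exact Dvd.dvd.mul_right ⟨a * (p * a) + a * (p * b) - b * (p * b), by ring⟩ _
      obtain ⟨c, hc⟩ := hpp.dvd_of_dvd_pow this
      exact hpp.dvd_of_dvd_pow (n := 2) ⟨c + a * v + b * w, by
        linear_combination hc + v * ha + w * hb⟩
  have hodd : Odd (v ^ 2 + v * w - w ^ 2) :=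
    ((hv.pow_of_ne_zero two_ne_zero).add (hv.mul_right w)).sub_odd hw.pow
  have hco : IsCoprime (v ^ 2 + v * w - w ^ 2) (u * v + w ^ 2) := by
    refine isCoprime_of_prime_dvd (fun h0 => ?_) fun p hpp hp1 hp3 => ?_
    · simp [h0.1] at hodd
    · have hp2 : ¬ p ∣ 2 := by
        obtain ⟨k, hk⟩ := hodd
        exact IsCoprime.not_dvd_of_prime ⟨1, -k, by linear_combination hk⟩ hpp hp1
      have hpQ : p ∣ u ^ 2 - v ^ 2 - w ^ 2 :=
        hpp.dvd_of_dvd_pow (h ▸ hp1.mul_right _ : p ∣ (u ^ 2 - v ^ 2 - w ^ 2) ^ 2)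
      have hpw : p ∣ w := by
        have hprod : p ∣ 2 * (w ^ 3 * (w - 2 * v)) :=
          (dvd_sub (dvd_sub (hp3.mul_right (u * v - w ^ 2)) (hpQ.mul_right (v ^ 2)))
            (hp1.mul_right (v ^ 2 + (w ^ 2 - v * w) + 2 * w ^ 2))).trans (dvd_of_eq (by ring))
        rcases hpp.dvd_or_dvd ((hpp.dvd_or_dvd hprod).resolve_left hp2) with hpw | hpw
        · exact hpp.dvd_of_dvd_pow hpw
        · have hpv : p ∣ v ^ 2 :=
            (dvd_sub (hpw.mul_right (-v - w)) hp1).trans (dvd_of_eq (by ring))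
          exact (dvd_add hpw ((hpp.dvd_of_dvd_pow hpv).mul_left 2)).trans (dvd_of_eq (by ring))
      have hpv : p ∣ v ^ 2 :=
        (dvd_add hp1 (hpw.mul_right (w - v))).trans (dvd_of_eq (by ring))
      exact hvw.not_dvd_of_prime hpp (hpp.dvd_of_dvd_pow hpv) hpw
  obtain ⟨r, hr⟩ := Int.sq_of_isCoprime hco h
  obtain ⟨s, hs⟩ := Int.sq_of_isCoprime hco.symm ((mul_comm _ _).trans h)
  have hs : u * v + w ^ 2 = s ^ 2 := by
    refine hs.resolve_right fun hs => ?_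
    obtain ⟨a, rfl⟩ := hu
    obtain ⟨b, rfl⟩ := hv
    obtain ⟨c, rfl⟩ := hw
    have key : ∀ a b c s : ZMod 4,
        (a + a) * (b + b) + (2 * c + 1) ^ 2 ≠ -s ^ 2 := by decide
    exact key a b c s (by exact_mod_cast congrArg (Int.cast : ℤ → ZMod 4) hs)
  have hr : v ^ 2 + v * w - w ^ 2 = r ^ 2 := by
    refine hr.resolve_right fun hr => ?_
    have hs0 : 0 < u * v + w ^ 2 := by
      rw [hs]
      refine sq_pos_of_ne_zero ?_
      rintro rfl
      have : Odd (u * v + w ^ 2) := (hu.mul_right v).add_odd hw.pow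
      simp [hs] at this
    have hr0 : 0 ≤ v ^ 2 + v * w - w ^ 2 :=
      nonneg_of_mul_nonneg_left (h ▸ sq_nonneg _) hs0
    have : r = 0 := by nlinarith [sq_nonneg r, pow_eq_zero_iff (a := r) two_ne_zero]
    simp [hr, this] at hodd
  rw [hr, hs, ← mul_pow, eq_comm, sq_eq_sq_iff_eq_or_eq_neg] at h
  rcases h with h | h
  · exact not_quarticCover u v w r s ⟨hr, hs, h, hvw, hu, hv, hw⟩
  · exact not_quarticCover u v w r (-s)
      ⟨hr, by rw [hs, neg_sq], by rw [h, mul_neg], hvw, hu, hv, hw⟩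

theorem Int.eq_zero_of_quartic {u v w : ℤ}
    (h : (v ^ 2 + v * w - w ^ 2) * (u * v + w ^ 2) = (u ^ 2 - v ^ 2 - w ^ 2) ^ 2) :
    u = 0 ∧ v = 0 ∧ w = 0 := by
  obtain ⟨g, hg, hgcd⟩ := Finset.extract_gcd ![u, v, w] (s := Finset.univ) Finset.univ_nonempty
  set d := Finset.univ.gcd ![u, v, w]
  have hu : u = d * g 0 := hg 0 (Finset.mem_univ _)
  have hv : v = d * g 1 := hg 1 (Finset.mem_univ _)
  have hw : w = d * g 2 := hg 2 (Finset.mem_univ _)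
  by_cases hd : d = 0
  · simp [hu, hv, hw, hd]
  · refine absurd (mul_left_cancel₀ (pow_ne_zero 4 hd) ?_)
      (Int.quartic_ne_of_primitive (u := g 0) (v := g 1) (w := g 2) fun p hp h0 h1 h2 => ?_)
    · rw [hu, hv, hw] at h
      linear_combination h
    · refine hp.not_isUnit (isUnit_of_dvd_one (hgcd ▸ Finset.dvd_gcd fun i _ => ?_))
      fin_cases i
      exacts [h0, h1, h2]

/-- The plane quartic `(v² + vw − w²)(uv + w²) = (u² − v² − w²)²` has no
rational points: the only rational solution of the homogeneous equation is the zero triple. -/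
theorem quartic_no_rational_points :
    ∀ u v w : ℚ,
      (v ^ 2 + v * w - w ^ 2) * (u * v + w ^ 2) = (u ^ 2 - v ^ 2 - w ^ 2) ^ 2 →
      u = 0 ∧ v = 0 ∧ w = 0 := by
  intro u v w h
  obtain ⟨d, hd⟩ := IsLocalization.exist_integer_multiples_of_finset (nonZeroDivisors ℤ) {u, v, w}
  have hd0 : ((d : ℤ) : ℚ) ≠ 0 := Int.cast_ne_zero.2 (nonZeroDivisors.coe_ne_zero d)
  obtain ⟨a, ha⟩ := hd u (by simp)
  obtain ⟨b, hb⟩ := hd v (by simp)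
  obtain ⟨c, hc⟩ := hd w (by simp)
  simp only [zsmul_eq_mul, algebraMap_int_eq, eq_intCast] at ha hb hc
  have habc : (b ^ 2 + b * c - c ^ 2) * (a * b + c ^ 2) = (a ^ 2 - b ^ 2 - c ^ 2) ^ 2 := by
    rw [← Int.cast_inj (α := ℚ)]
    push_cast
    rw [ha, hb, hc]
    linear_combination ((d : ℤ) : ℚ) ^ 4 * h
  obtain ⟨rfl, rfl, rfl⟩ := Int.eq_zero_of_quartic habc
  simpa [hd0, eq_comm] using And.intro ha (And.intro hb hc)
end

section
/- The plane quartic C : (v² + vw − w²)(uv + w²) = (u² − v² − w²)² has points over ℝ and over ℚ_p for every prime p. -/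
open Polynomial

/-- The dehomogenization at `w = 1` of `(u² − v² − w²)² − (v² + vw − w²)(uv + w²)`, as a monic
polynomial in `u` over `R[v]`. -/
noncomputable def quartic (R : Type*) [CommRing R] : R[X][X] :=
  X ^ 4 - C (2 * (X ^ 2 + 1)) * X ^ 2 - C ((X ^ 2 + X - 1) * X) * X + C (X ^ 4 + X ^ 2 - X + 2)

section Irreducible

theorem quartic_natDegree (R : Type*) [CommRing R] [Nontrivial R] : (quartic R).natDegree = 4 := by
  unfold quartic; compute_degree!

theorem quartic_monic (R : Type*) [CommRing R] : (quartic R).Monic := by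
  unfold quartic; monicity!

theorem natDegree_le_one_of_root {F : Type*} [Field F] {u : F[X]}
    (h : (u ^ 2 - (X ^ 2 + 1)) ^ 2 = (X ^ 2 + X - 1) * (u * X + 1)) : u.natDegree ≤ 1 := by
  by_contra! hn
  have h1 : (u ^ 2 - (X ^ 2 + 1)).natDegree = 2 * u.natDegree := by
    rw [natDegree_sub_eq_left_of_natDegree_lt, natDegree_pow]
    rw [natDegree_pow]
    have : (X ^ 2 + 1 : F[X]).natDegree = 2 := by compute_degree!
    omega
  have h2 : ((X ^ 2 + X - 1 : F[X]) * (u * X + 1)).natDegree ≤ 2 + (u.natDegree + 1) := by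
    compute_degree
  rw [← h, natDegree_pow, h1] at h2
  omega

theorem quartic_no_root {F : Type*} [Field F] (h5 : (5 : F) ≠ 0) {u : F[X]} :
    (u ^ 2 - (X ^ 2 + 1)) ^ 2 ≠ (X ^ 2 + X - 1) * (u * X + 1) := by
  intro h
  obtain ⟨a, b, rfl⟩ := exists_eq_X_add_C_of_natDegree_le_one (natDegree_le_one_of_root h)
  have key : C ((a ^ 2 - 1) ^ 2 - a) * X ^ 4 + C (4 * a * b * (a ^ 2 - 1) - a - b) * X ^ 3
      + C (4 * a ^ 2 * b ^ 2 + 2 * (a ^ 2 - 1) * (b ^ 2 - 1) - 1 - b + a) * X ^ 2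
      + C (4 * a * b * (b ^ 2 - 1) - 1 + b) * X + C ((b ^ 2 - 1) ^ 2 + 1) = 0 := by
    simp only [map_sub, map_add, map_mul, map_pow, map_one, map_ofNat]
    linear_combination h
  have k4 := congrArg (coeff · 4) key
  have k3 := congrArg (coeff · 3) key
  have k2 := congrArg (coeff · 2) key
  have k1 := congrArg (coeff · 1) key
  have k0 := congrArg (coeff · 0) key
  simp [coeff_X, coeff_C, coeff_X_pow, -map_sub, -map_add, -map_mul, -map_pow] at k4 k3 k2 k1 k0
  clear key h
  have e1 : (2 * a * b - (a ^ 2 - 1)) ^ 2 + (a ^ 2 + b ^ 2 - 2) ^ 2 = 0 := by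
    linear_combination k0 + k2 - k3 + 2 * k4
  have e2 : (2 * a * b - (a ^ 2 - 1)) *
      (2 * (a ^ 2 + b ^ 2 - 2) - (2 * a * b - (a ^ 2 - 1))) = 0 := by
    linear_combination k1 - k2 + 2 * k3 - 3 * k4
  have e3 : a ^ 2 + b ^ 2 - 2 = 0 := by
    rcases mul_eq_zero.1 e2 with e | e
    · exact pow_eq_zero_iff two_ne_zero |>.1 (by
        linear_combination e1 - (2 * a * b - (a ^ 2 - 1)) * e)
    · have : 5 * (a ^ 2 + b ^ 2 - 2) ^ 2 = 0 := by
        linear_combination e1 + (2 * a * b - (a ^ 2 - 1) + 2 * (a ^ 2 + b ^ 2 - 2)) * e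
      simpa [h5] using this
  have e4 : a = -1 := by
    linear_combination k0 - k4 + (a ^ 2 - b ^ 2) * e3
  subst e4
  exact one_ne_zero (α := F) (by linear_combination k4)

theorem quartic_no_quadratic_factor {F : Type*} [Field F] (h3 : (3 : F) ≠ 0)
    (h5 : (5 : F) ≠ 0) {r : F[X]} :
    r ^ 2 * (r ^ 4 - 4 * (X ^ 2 + 1) * r ^ 2 + 4 * (X ^ 2 + X - 1)) ≠
      ((X ^ 2 + X - 1) * X) ^ 2 := by
  intro h
  have hn : r.natDegree ≤ 1 := by
    by_contra! hn
    have h1 : (r ^ 4 - (4 * (X ^ 2 + 1) * r ^ 2 - 4 * (X ^ 2 + X - 1))).natDegree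
        = 4 * r.natDegree := by
      rw [natDegree_sub_eq_left_of_natDegree_lt, natDegree_pow]
      rw [natDegree_pow]
      have : (4 * (X ^ 2 + 1) * r ^ 2 - 4 * (X ^ 2 + X - 1)).natDegree
          ≤ 2 + 2 * r.natDegree := by
        compute_degree
      omega
    have h2 : (((X ^ 2 + X - 1 : F[X]) * X) ^ 2).natDegree ≤ 6 := by compute_degree
    have hr : r ≠ 0 := by rintro rfl; simp at hn
    have hr' : r ^ 4 - (4 * (X ^ 2 + 1) * r ^ 2 - 4 * (X ^ 2 + X - 1)) ≠ 0 := by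
      intro h0; rw [h0] at h1; simp at h1; omega
    rw [← h, sub_add, natDegree_mul (pow_ne_zero 2 hr) hr', natDegree_pow, h1] at h2
    omega
  obtain ⟨a, b, rfl⟩ := exists_eq_X_add_C_of_natDegree_le_one hn
  have key : C (a ^ 6 - 4 * a ^ 4 - 1) * X ^ 6 + C (6 * a ^ 5 * b - 16 * a ^ 3 * b - 2) * X ^ 5
      + C (15 * a ^ 4 * b ^ 2 - 4 * a ^ 4 - 24 * a ^ 2 * b ^ 2 + 4 * a ^ 2 + 1) * X ^ 4
      + C (20 * a ^ 3 * b ^ 3 - 16 * a ^ 3 * b - 16 * a * b ^ 3 + 8 * a * b + 4 * a ^ 2 + 2) * X ^ 3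
      + C (15 * a ^ 2 * b ^ 4 - 24 * a ^ 2 * b ^ 2 - 4 * b ^ 4 + 4 * b ^ 2 + 8 * a * b - 4 * a ^ 2
          - 1) * X ^ 2
      + C (6 * a * b ^ 5 - 16 * a * b ^ 3 + 4 * b ^ 2 - 8 * a * b) * X
      + C (b ^ 6 - 4 * b ^ 4 - 4 * b ^ 2) = 0 := by
    simp only [map_sub, map_add, map_mul, map_pow, map_one, map_ofNat]
    linear_combination h
  have k6 := congrArg (coeff · 6) key
  have k5 := congrArg (coeff · 5) key
  have k4 := congrArg (coeff · 4) key
  have k3 := congrArg (coeff · 3) key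
  have k2 := congrArg (coeff · 2) key
  have k1 := congrArg (coeff · 1) key
  have k0 := congrArg (coeff · 0) key
  simp [coeff_X, coeff_C, coeff_X_pow, -map_sub, -map_add, -map_mul, -map_pow]
    at k6 k5 k4 k3 k2 k1 k0
  clear key h
  by_cases hb : b = 0
  · subst hb
    have : (3 : F) ^ 4 = 0 := by
      linear_combination -64 * k6 - (16 * a ^ 4 - 68 * a ^ 2 + 17) * k2
    exact h3 (pow_eq_zero_iff four_ne_zero |>.1 this)
  have ha : a ≠ 0 := by
    rintro rfl
    simp at k6
  obtain ⟨t, rfl⟩ : ∃ t, b = -a * t := ⟨-b / a, by field_simp⟩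
  have ht : t ≠ 0 := by
    rintro rfl
    simp at hb
  have hm : t ^ 2 + t - 1 = 0 := by
    have : ((t ^ 2 + t - 1) * t) ^ 2 = 0 := by
      linear_combination -k0 - t * k1 - t ^ 2 * k2 - t ^ 3 * k3 - t ^ 4 * k4 - t ^ 5 * k5
        - t ^ 6 * k6
    simpa [ht] using this
  have hm' : (t * (2 * t + 1)) ^ 2 = 0 := by
    linear_combination (4 * a ^ 2 - (t ^ 2 + t - 1) - 2 * t * (2 * t + 1) - t * (6 * t + 2)) * hm
      - k2 - 3 * t * k3 - 6 * t ^ 2 * k4 - 10 * t ^ 3 * k5 - 15 * t ^ 4 * k6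
  have hm'' : 2 * t + 1 = 0 := by simpa [ht] using hm'
  exact h5 (by linear_combination (2 * t + 1) * hm'' - 4 * hm)

theorem quartic_irreducible {F : Type*} [Field F] (h3 : (3 : F) ≠ 0)
    (h5 : (5 : F) ≠ 0) : Irreducible (quartic F) := by
  rw [(quartic_monic F).irreducible_iff_natDegree', quartic_natDegree]
  refine ⟨fun h => by simpa [quartic_natDegree] using congrArg natDegree h, ?_⟩
  intro g h hg hh hgh hmem
  rw [Finset.mem_Ioc] at hmem
  obtain h1 | h1 : h.natDegree = 1 ∨ h.natDegree = 2 := by omega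
  · have hroot : (quartic F).eval (-h.coeff 0) = 0 := by
      rw [← hgh, eval_mul, hh.eq_X_add_C h1]; simp
    refine quartic_no_root h5 (u := -h.coeff 0) ?_
    simp only [quartic, eval_add, eval_sub, eval_mul, eval_pow, eval_X, eval_C] at hroot
    linear_combination hroot
  · have hgd : g.natDegree = 2 := by
      have := congrArg natDegree hgh
      rw [hg.natDegree_mul hh, quartic_natDegree] at this
      omega
    have expand : ∀ q : F[X][X], q.Monic → q.natDegree = 2 →
        q = X ^ 2 + C (q.coeff 1) * X + C (q.coeff 0) := by
      intro q hq hd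
      conv_lhs => rw [q.as_sum_range_C_mul_X_pow, hd]
      have : q.coeff 2 = 1 := by rw [← hd]; exact hq
      simp [Finset.sum_range_succ, this]; ring
    have hg' := expand g hg hgd
    have hh' := expand h hh h1
    generalize g.coeff 1 = r at hg'
    generalize g.coeff 0 = s at hg'
    generalize h.coeff 1 = r' at hh'
    generalize h.coeff 0 = t at hh'
    have key : C (r + r') * X ^ 3 + C (s + t + r * r' + 2 * (X ^ 2 + 1)) * X ^ 2
        + C (r * t + r' * s + (X ^ 2 + X - 1) * X) * X
        + C (s * t - (X ^ 4 + X ^ 2 - X + 2)) = 0 := by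
      rw [hg', hh', quartic] at hgh
      simp only [map_add, map_mul, map_sub, map_pow] at hgh ⊢
      linear_combination hgh
    have k3 : r + r' = 0 := by
      simpa [coeff_X, coeff_C, coeff_X_pow, -map_sub, -map_add, -map_mul, -map_pow]
        using congrArg (coeff · 3) key
    have k2 : s + t + r * r' + 2 * (X ^ 2 + 1) = 0 := by
      simpa [coeff_X, coeff_C, coeff_X_pow, -map_sub, -map_add, -map_mul, -map_pow]
        using congrArg (coeff · 2) key
    have k1 : r * t + r' * s + (X ^ 2 + X - 1) * X = 0 := by
      simpa [coeff_X, coeff_C, coeff_X_pow, -map_sub, -map_add, -map_mul, -map_pow]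
        using congrArg (coeff · 1) key
    have k0 : s * t - (X ^ 4 + X ^ 2 - X + 2) = 0 := by
      simpa [coeff_X, coeff_C, coeff_X_pow, -map_sub, -map_add, -map_mul, -map_pow]
        using congrArg (coeff · 0) key
    obtain rfl : r' = -r := by linear_combination k3
    refine quartic_no_quadratic_factor h3 h5 (r := r) ?_
    linear_combination -r ^ 2 * (r ^ 2 - 2 * (X ^ 2 + 1) + (s + t)) * k2
      + (r * (t - s) - (X ^ 2 + X - 1) * X) * k1 + 4 * r ^ 2 * k0
end Irreducible

/-- The coordinate ring of the affine quartic `quartic R = 0`. -/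
abbrev QuarticRing (R : Type*) [CommRing R] : Type _ := AdjoinRoot (quartic R)

namespace QuarticRing

/-- The first coordinate function (the variable of the coefficients of `quartic R`). -/
noncomputable def x (R : Type*) [CommRing R] : QuarticRing R := AdjoinRoot.of (quartic R) X

/-- The second coordinate function (the adjoined root). -/
noncomputable def y (R : Type*) [CommRing R] : QuarticRing R := AdjoinRoot.root (quartic R)

section Coordinates

variable {R : Type*} [CommRing R]

theorem eval₂_quartic {S : Type*} [CommRing S] (i : R[X] →+* S) (s : S) :
    (quartic R).eval₂ i s = s ^ 4 - 2 * (i X ^ 2 + 1) * s ^ 2 - (i X ^ 2 + i X - 1) * i X * s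
      + (i X ^ 4 + i X ^ 2 - i X + 2) := by
  unfold quartic
  simp only [eval₂_add, eval₂_sub, eval₂_mul, eval₂_pow, eval₂_X, eval₂_C, map_add, map_sub,
    map_mul, map_pow, map_one, map_ofNat, eval₂_ofNat, eval₂_one]

theorem relation : (y R) ^ 4 - 2 * (x R ^ 2 + 1) * y R ^ 2 - (x R ^ 2 + x R - 1) * x R * y R
    + (x R ^ 4 + x R ^ 2 - x R + 2) = 0 := by
  rw [← AdjoinRoot.eval₂_root (quartic R), eval₂_quartic]
  rfl

theorem of_eq_aeval (w : R[X]) : AdjoinRoot.of (quartic R) w = aeval (x R) w := by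
  have : (AdjoinRoot.ofAlgHom R (quartic R)) = aeval (x R) := by
    ext
    simp [x]
  exact DFunLike.congr_fun this w

/-- The coefficient of `y ^ i` in the representation of degree less than four in `y`. -/
noncomputable def coord (i : ℕ) : QuarticRing R →ₗ[R[X]] R[X] :=
  (lcoeff R[X] i).comp (AdjoinRoot.modByMonicHom (quartic_monic R))

theorem eq_zero_of_coord_eq_zero {z : QuarticRing R} (h : ∀ i, coord i z = 0) : z = 0 := by
  rw [← AdjoinRoot.mk_leftInverse (quartic_monic R) z]
  have : AdjoinRoot.modByMonicHom (quartic_monic R) z = 0 := by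
    ext1 i
    exact h i
  rw [this, map_zero]

theorem coord_of_mul_y_pow [Nontrivial R] (w : R[X]) {i : ℕ} (hi : i < 4) (j : ℕ) :
    coord j (AdjoinRoot.of (quartic R) w * y R ^ i) = if j = i then w else 0 := by
  have : AdjoinRoot.of (quartic R) w * y R ^ i = AdjoinRoot.mk (quartic R) (C w * X ^ i) := by
    simp [y]
  rw [this, coord, LinearMap.comp_apply, AdjoinRoot.modByMonicHom_mk,
    (modByMonic_eq_self_iff (quartic_monic R)).2, lcoeff_apply, coeff_C_mul_X_pow]
  refine (degree_C_mul_X_pow_le _ _).trans_lt ?_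
  rw [degree_eq_natDegree (quartic_monic R).ne_zero, quartic_natDegree]
  exact_mod_cast hi

theorem eq_zero_of_sum_eq_zero [Nontrivial R] {w : Fin 4 → R[X]}
    (h : ∑ i, AdjoinRoot.of (quartic R) (w i) * y R ^ (i : ℕ) = 0) : w = 0 := by
  funext j
  have := congrArg (coord (R := R) j) h
  simpa [map_sum, coord_of_mul_y_pow, Fin.val_inj] using this

theorem coord_of_mul (i : ℕ) (l : R[X]) (z : QuarticRing R) :
    coord i (AdjoinRoot.of (quartic R) l * z) = l * coord i z := by
  rw [← smul_eq_mul l, ← map_smul, Algebra.smul_def, AdjoinRoot.algebraMap_eq]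

theorem nontrivial [Nontrivial R] : Nontrivial (QuarticRing R) := by
  refine ⟨1, 0, fun h => ?_⟩
  have := congrArg (coord (R := R) 0) h
  rw [map_zero] at this
  have h1 := coord_of_mul_y_pow (R := R) 1 (i := 0) (by norm_num) 0
  simp [this] at h1

end Coordinates

section Filtration

variable (F : Type*) [Field F]

/-- The functions of total degree at most `d` in the coordinates. -/
noncomputable def degLE (d : ℕ) : Submodule F (QuarticRing F) :=
  Submodule.span F {z | ∃ a b, a + b ≤ d ∧ z = x F ^ a * y F ^ b}

variable {F}

theorem monomial_mem_degLE {a b d : ℕ} (h : a + b ≤ d) : x F ^ a * y F ^ b ∈ degLE F d :=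
  Submodule.subset_span ⟨a, b, h, rfl⟩

theorem degLE_mono {d e : ℕ} (h : d ≤ e) : degLE F d ≤ degLE F e :=
  Submodule.span_mono fun _ ⟨a, b, hab, hz⟩ => ⟨a, b, hab.trans h, hz⟩

theorem x_mem_degLE : x F ∈ degLE F 1 := by
  simpa using monomial_mem_degLE (F := F) (a := 1) (b := 0) le_rfl

theorem one_mem_degLE : (1 : QuarticRing F) ∈ degLE F 0 := by
  simpa using monomial_mem_degLE (F := F) (a := 0) (b := 0) le_rfl

theorem mul_mem_degLE {d e : ℕ} {z w : QuarticRing F} (hz : z ∈ degLE F d) (hw : w ∈ degLE F e) :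
    z * w ∈ degLE F (d + e) := by
  have h : z * w ∈ degLE F d * degLE F e := Submodule.mul_mem_mul hz hw
  rw [degLE, degLE, Submodule.span_mul_span] at h
  refine Submodule.span_mono ?_ h
  rintro _ ⟨_, ⟨a, b, hab, rfl⟩, _, ⟨a', b', hab', rfl⟩, rfl⟩
  exact ⟨a + a', b + b', by omega, by ring⟩

theorem pow_mem_degLE {d : ℕ} {z : QuarticRing F} (hz : z ∈ degLE F d) (n : ℕ) :
    z ^ n ∈ degLE F (n * d) := by
  induction n with
  | zero => simpa using one_mem_degLE
  | succ n ih =>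
    rw [pow_succ, Nat.succ_mul]
    exact mul_mem_degLE ih hz

theorem y_pow_four_mul (z : QuarticRing F) : y F ^ 4 * z =
    (2 : F) • (x F ^ 2 * y F ^ 2 * z) + (2 : F) • (y F ^ 2 * z) + x F ^ 3 * y F * z
      + x F ^ 2 * y F * z - x F * y F * z - x F ^ 4 * z - x F ^ 2 * z + x F * z - (2 : F) • z := by
  simp only [Algebra.smul_def, map_ofNat]
  linear_combination z * relation (R := F)

theorem degLE_le {d : ℕ} {V : Submodule F (QuarticRing F)}
    (h : ∀ a b, b < 4 → a + b ≤ d → x F ^ a * y F ^ b ∈ V) : degLE F d ≤ V := by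
  refine Submodule.span_le.2 ?_
  rintro _ ⟨a, b, hab, rfl⟩
  induction b using Nat.strong_induction_on generalizing a with
  | _ b ih =>
    by_cases hb : b < 4
    · exact h a b hb hab
    obtain ⟨c, rfl⟩ : ∃ c, b = 4 + c := ⟨b - 4, by omega⟩
    have key : ∀ a' b', b' < 4 → a' + b' ≤ 4 →
        x F ^ a' * y F ^ b' * (x F ^ a * y F ^ c) ∈ V := by
      intro a' b' hb' hab'
      have := ih (b' + c) (by omega) (a' + a) (by omega)
      rwa [pow_add, pow_add, mul_mul_mul_comm] at this
    rw [pow_add, mul_left_comm, y_pow_four_mul]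
    have k22 := key 2 2 (by norm_num) (by norm_num)
    have k02 := key 0 2 (by norm_num) (by norm_num)
    have k31 := key 3 1 (by norm_num) (by norm_num)
    have k21 := key 2 1 (by norm_num) (by norm_num)
    have k11 := key 1 1 (by norm_num) (by norm_num)
    have k40 := key 4 0 (by norm_num) (by norm_num)
    have k20 := key 2 0 (by norm_num) (by norm_num)
    have k10 := key 1 0 (by norm_num) (by norm_num)
    have k00 := key 0 0 (by norm_num) (by norm_num)
    simp only [pow_zero, pow_one, one_mul, mul_one] at k22 k02 k31 k21 k11 k40 k20 k10 k00
    exact V.sub_mem (V.add_mem (V.sub_mem (V.sub_mem (V.sub_mem (V.add_mem (V.add_mem (V.add_mem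
      (V.smul_mem _ k22) (V.smul_mem _ k02)) k31) k21) k11) k40) k20) k10) (V.smul_mem _ k00)

theorem degLE_eq_span (d : ℕ) : degLE F d ≤
    Submodule.span F (Set.range fun q : Fin (d + 1) × Fin 4 => x F ^ (q.1 : ℕ) * y F ^ (q.2 : ℕ)) :=
  degLE_le fun a b hb hab =>
    Submodule.subset_span ⟨(⟨a, by omega⟩, ⟨b, hb⟩), rfl⟩

instance finite_degLE (d : ℕ) : Module.Finite F (degLE F d) :=
  have := FiniteDimensional.span_of_finite F (Set.finite_range
    fun q : Fin (d + 1) × Fin 4 => x F ^ (q.1 : ℕ) * y F ^ (q.2 : ℕ))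
  Submodule.finiteDimensional_of_le (degLE_eq_span d)

theorem finrank_degLE_le (d : ℕ) : Module.finrank F (degLE F d) ≤ (d + 1) * 4 := by
  have := FiniteDimensional.span_of_finite F (Set.finite_range
    fun q : Fin (d + 1) × Fin 4 => x F ^ (q.1 : ℕ) * y F ^ (q.2 : ℕ))
  refine (Submodule.finrank_mono (degLE_eq_span d)).trans ?_
  refine (finrank_range_le_card _).trans ?_
  simp

theorem natDegree_coord_le {d : ℕ} {z : QuarticRing F} (hz : z ∈ degLE F d) (i : ℕ) :
    (coord i z).natDegree ≤ d := by
  have h : degLE F d ≤ (degreeLE F d).comap ((coord i).restrictScalars F) := by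
    refine degLE_le fun a b hb hab => ?_
    have h1 : x F ^ a * y F ^ b = AdjoinRoot.of (quartic F) (X ^ a) * y F ^ b := by simp [x]
    rw [Submodule.mem_comap, LinearMap.restrictScalars_apply, h1, coord_of_mul_y_pow _ hb,
      mem_degreeLE]
    split_ifs
    · rw [degree_X_pow]
      exact_mod_cast (by omega : a ≤ d)
    · simp
  exact natDegree_le_iff_degree_le.2 (mem_degreeLE.1 (h hz))

theorem eq_zero_of_dvd_of_mem_degLE {d : ℕ} {z : QuarticRing F} (hz : z ∈ degLE F d) {l : F[X]}
    (hl : d < l.natDegree) (h : AdjoinRoot.of (quartic F) l ∣ z) : z = 0 := by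
  obtain ⟨w, rfl⟩ := h
  refine eq_zero_of_coord_eq_zero fun i => ?_
  refine eq_zero_of_dvd_of_natDegree_lt ?_ ((natDegree_coord_le hz i).trans_lt hl)
  rw [coord_of_mul]
  exact dvd_mul_right _ _

end Filtration

section Derivation

variable {R : Type*} [CommRing R]

/-- The derivative of the equation of the curve with respect to `x`. -/
noncomputable def fx : QuarticRing R :=
  4 * x R ^ 3 + 2 * x R - 1 - 4 * x R * y R ^ 2 - (3 * x R ^ 2 + 2 * x R - 1) * y R

/-- The derivative of the equation of the curve with respect to `y`. -/
noncomputable def fy : QuarticRing R :=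
  4 * y R ^ 3 - 4 * (x R ^ 2 + 1) * y R - (x R ^ 2 + x R - 1) * x R

theorem exists_derivation : ∃ D : Derivation R (QuarticRing R) (QuarticRing R),
    D (x R) = fy ∧ D (y R) = -fx := by
  let i : R[X] →ₐ[R] DualNumber (QuarticRing R) :=
    aeval (TrivSqZeroExt.inl (x R) + TrivSqZeroExt.inr fy)
  have hi : (quartic R).eval₂ (i : R[X] →+* DualNumber (QuarticRing R))
      (TrivSqZeroExt.inl (y R) + TrivSqZeroExt.inr (-fx)) = 0 := by
    rw [eval₂_quartic, RingHom.coe_coe, aeval_X]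
    have two : (2 : DualNumber (QuarticRing R)) = TrivSqZeroExt.inl 2 := rfl
    rw [two]
    ext
    · simpa using relation (R := R)
    · simp [fx, fy]
      ring
  let φ := AdjoinRoot.liftAlgHom (quartic R) i _ hi
  have hx : φ (x R) = TrivSqZeroExt.inl (x R) + TrivSqZeroExt.inr fy := by simp [φ, x, i]
  have hy : φ (y R) = TrivSqZeroExt.inl (y R) + TrivSqZeroExt.inr (-fx) := by simp [φ, y]
  have hφ : ∀ z, (φ z).fst = z := by
    intro z
    have : (TrivSqZeroExt.fstHom R _ _).comp φ = AlgHom.id R (QuarticRing R) := by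
      refine AdjoinRoot.algHom_ext' ?_ ?_
      · ext
        simpa [x] using congrArg TrivSqZeroExt.fst hx
      · simpa [y] using congrArg TrivSqZeroExt.fst hy
    exact DFunLike.congr_fun this z
  refine ⟨Derivation.mk' ((TrivSqZeroExt.sndHom (QuarticRing R) (QuarticRing R)).restrictScalars R
    ∘ₗ φ.toLinearMap) ?_, ?_, ?_⟩
  · intro a b
    simp [hφ, mul_comm]
  · simp [hx]
  · simp [hy]

end Derivation

section Congruence

variable {p : ℕ} [Fact p.Prime]

instance charP : CharP (QuarticRing (ZMod p)) p :=
  have := nontrivial (R := ZMod p)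
  charP_of_injective_algebraMap (algebraMap (ZMod p) (QuarticRing (ZMod p))).injective p

theorem fy_mem_of_isPrime
    (H : ∀ a b : ZMod p, b ^ 4 - 2 * (a ^ 2 + 1) * b ^ 2 - (a ^ 2 + a - 1) * a * b
      + (a ^ 4 + a ^ 2 - a + 2) = 0 → 4 * b ^ 3 - 4 * (a ^ 2 + 1) * b - (a ^ 2 + a - 1) * a = 0)
    {m : Ideal (QuarticRing (ZMod p))} (hm : m.IsPrime) (hx : x (ZMod p) ^ p - x _ ∈ m)
    (hy : y (ZMod p) ^ p - y _ ∈ m) : fy ∈ m := by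
  let K := FractionRing (QuarticRing (ZMod p) ⧸ m)
  let θ : QuarticRing (ZMod p) →+* K := (algebraMap _ K).comp (Ideal.Quotient.mk m)
  have hθ : ∀ z, θ z = 0 ↔ z ∈ m := by
    intro z
    rw [← Ideal.Quotient.eq_zero_iff_mem, RingHom.comp_apply,
      map_eq_zero_iff _ (IsFractionRing.injective _ K)]
  have : CharP K p := charP_of_injective_algebraMap (algebraMap (ZMod p) K).injective p
  have rational : ∀ z : K, z ^ p - z = 0 → ∃ a : ZMod p, algebraMap (ZMod p) K a = z := by
    intro z hz
    have := (Subfield.mem_bot_iff_pow_eq_self K p).2 (sub_eq_zero.1 hz)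
    rw [← ZMod.fieldRange_castHom_eq_bot p] at this
    obtain ⟨a, rfl⟩ := this
    exact ⟨a, congrArg (fun g : ZMod p →+* K => g a) (Subsingleton.elim _ _)⟩
  obtain ⟨a, ha⟩ := rational (θ (x _)) (by rw [← map_pow, ← map_sub, hθ]; exact hx)
  obtain ⟨b, hb⟩ := rational (θ (y _)) (by rw [← map_pow, ← map_sub, hθ]; exact hy)
  have hab := H a b <| (algebraMap (ZMod p) K).injective <| by
    simpa [ha, hb, map_ofNat] using congrArg θ (relation (R := ZMod p))
  rw [← hθ]
  simpa [fy, ha, hb, map_ofNat] using congrArg (algebraMap (ZMod p) K) hab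

theorem fy_mem_span
    (H : ∀ a b : ZMod p, b ^ 4 - 2 * (a ^ 2 + 1) * b ^ 2 - (a ^ 2 + a - 1) * a * b
      + (a ^ 4 + a ^ 2 - a + 2) = 0 → 4 * b ^ 3 - 4 * (a ^ 2 + 1) * b - (a ^ 2 + a - 1) * a = 0) :
    fy ∈ Ideal.span {x (ZMod p) ^ p - x _, y (ZMod p) ^ p - y _} := by
  set I := Ideal.span {x (ZMod p) ^ p - x _, y (ZMod p) ^ p - y _} with hI
  have hx : x (ZMod p) ^ p - x _ ∈ I := Ideal.subset_span (by simp)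
  have hy : y (ZMod p) ^ p - y _ ∈ I := Ideal.subset_span (by simp)
  have hrad : fy ∈ I.radical := by
    rw [Ideal.radical_eq_sInf, Ideal.mem_sInf]
    exact fun m ⟨hIm, hm⟩ => fy_mem_of_isPrime H hm (hIm hx) (hIm hy)
  obtain ⟨n, hn⟩ := hrad
  have hfrob : ∀ k, Ideal.Quotient.mk I (fy ^ p ^ k) = Ideal.Quotient.mk I fy := by
    intro k
    induction k with
    | zero => simp
    | succ k ih =>
      have hx' : Ideal.Quotient.mk I (x _) ^ p = Ideal.Quotient.mk I (x _) := by
        rw [← map_pow]; exact Ideal.Quotient.eq.2 hx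
      have hy' : Ideal.Quotient.mk I (y _) ^ p = Ideal.Quotient.mk I (y _) := by
        rw [← map_pow]; exact Ideal.Quotient.eq.2 hy
      have h1 : (fy : QuarticRing (ZMod p)) ^ p = 4 * (y _ ^ p) ^ 3
          - 4 * ((x _ ^ p) ^ 2 + 1) * y _ ^ p - ((x _ ^ p) ^ 2 + x _ ^ p - 1) * x _ ^ p := by
        simp only [fy, ← frobenius_def, map_sub, map_add, map_mul, map_pow, map_one, map_ofNat]
      rw [pow_succ, pow_mul', pow_right_comm, map_pow, ih, ← map_pow, h1]
      simp [fy, hx', hy']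
  have := hfrob n
  rw [← Ideal.Quotient.eq_zero_iff_mem, ← this, Ideal.Quotient.eq_zero_iff_mem]
  exact I.mem_of_dvd (pow_dvd_pow _ (Nat.lt_pow_self (Fact.out : p.Prime).one_lt).le) hn

theorem dvd_fy_mul
    (H : ∀ a b : ZMod p, b ^ 4 - 2 * (a ^ 2 + 1) * b ^ 2 - (a ^ 2 + a - 1) * a * b
      + (a ^ 4 + a ^ 2 - a + 2) = 0 → 4 * b ^ 3 - 4 * (a ^ 2 + 1) * b - (a ^ 2 + a - 1) * a = 0) :
    x (ZMod p) ^ p - x _ ∣ fy * ((y _ ^ p) ^ 3 + y _ * (y _ ^ p) ^ 2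
      + (y _ ^ 2 - 2 * (x _ ^ 2 + 1)) * y _ ^ p
      + (y _ ^ 3 - 2 * (x _ ^ 2 + 1) * y _ - (x _ ^ 2 + x _ - 1) * x _)) := by
  obtain ⟨α, β, h⟩ := Ideal.mem_span_pair.1 (fy_mem_span H)
  have hrel := congrArg (frobenius (QuarticRing (ZMod p)) p) (relation (R := ZMod p))
  simp only [map_sub, map_add, map_mul, map_pow, map_one, map_ofNat, map_zero, frobenius_def]
    at hrel
  have h0 := relation (R := ZMod p)
  generalize y (ZMod p) ^ p = T at *
  generalize x (ZMod p) ^ p = z at *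
  generalize x (ZMod p) = x at *
  generalize y (ZMod p) = y at *
  rw [← h]
  refine ⟨α * (T ^ 3 + y * T ^ 2 + (y ^ 2 - 2 * (x ^ 2 + 1)) * T
    + (y ^ 3 - 2 * (x ^ 2 + 1) * y - (x ^ 2 + x - 1) * x)) + β * (2 * (x + z) * T ^ 2
    + (x ^ 2 + x * z + z ^ 2 + x + z - 1) * T - (x + z) * (x ^ 2 + z ^ 2) - (x + z) + 1), ?_⟩
  linear_combination β * hrel - β * h0

end Congruence

section Multiplicity

variable {R A : Type*} [CommRing R] [CommRing A] [Algebra R A] (D : Derivation R A A)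

theorem dvd_iterate_mul {L φ : A} {j : ℕ} {G : A} (h : ∀ i ≤ j, L ∣ φ * D^[i] G) (b : A) :
    ∀ i ≤ j, L ∣ φ * D^[i] (b * G) := by
  have hadd : ∀ i (u v : A), D^[i] (u + v) = D^[i] u + D^[i] v := iterate_map_add D
  induction j generalizing G b with
  | zero =>
    intro i hi
    obtain rfl : i = 0 := by omega
    have := (h 0 le_rfl).mul_left b
    simpa [mul_left_comm] using this
  | succ j ih =>
    rintro (_ | i) hi
    · have := (h 0 (by omega)).mul_left b
      simpa [mul_left_comm] using this
    · rw [Function.iterate_succ_apply, D.leibniz, smul_eq_mul, smul_eq_mul, mul_comm G, hadd,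
        mul_add]
      refine dvd_add (ih (fun i hi => ?_) b i (by omega))
        (ih (fun i hi => h i (by omega)) _ i (by omega))
      rw [← Function.iterate_succ_apply]
      exact h (i + 1) (by omega)

theorem dvd_iterate_pow_mul_sub (L : A) (j : ℕ) (H : A) :
    L ∣ D^[j] (L ^ j * H) - j.factorial * (D L) ^ j * H := by
  induction j generalizing H with
  | zero => simp
  | succ j ih =>
    have h1 : D (L ^ (j + 1) * H) = L ^ j * ((j + 1) * D L * H + L * D H) := by
      rw [D.leibniz, D.leibniz_pow]
      simp only [smul_eq_mul, nsmul_eq_mul, Nat.add_sub_cancel, Nat.cast_add, Nat.cast_one]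
      ring
    rw [Function.iterate_succ_apply, h1]
    obtain ⟨c, hc⟩ := ih ((j + 1) * D L * H + L * D H)
    refine ⟨c + j.factorial * D L ^ j * D H, ?_⟩
    rw [Nat.factorial_succ]
    push_cast
    linear_combination hc

theorem pow_dvd_of_dvd_iterate {L φ G : A} (hL : D L = -φ) {M : ℕ}
    (hM : ∀ j < M, IsUnit (j.factorial : A)) (h : ∀ i < M, L ∣ φ * D^[i] G) :
    ∃ e ≤ M * (M + 1) / 2, L ^ M ∣ φ ^ e * G := by
  induction M with
  | zero => exact ⟨0, by simp⟩
  | succ j ih =>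
    obtain ⟨e, he, H, hH⟩ := ih (fun i hi => hM i (by omega)) (fun i hi => h i (by omega))
    have h1 := dvd_iterate_mul D (j := j) (fun i hi => h i (by omega)) (φ ^ e) j le_rfl
    rw [hH] at h1
    obtain ⟨c, hc⟩ := dvd_iterate_pow_mul_sub D L j H
    have h2 : L ∣ φ ^ (j + 1) * H := by
      have h3 : L ∣ φ * (j.factorial * (-φ) ^ j * H) := by
        rw [← hL]
        have : φ * (j.factorial * (D L) ^ j * H) = φ * D^[j] (L ^ j * H) - L * (φ * c) := by
          linear_combination -φ * hc
        rw [this]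
        exact dvd_sub h1 (dvd_mul_right _ _)
      have h4 : φ * (j.factorial * (-φ) ^ j * H)
          = (j.factorial * (-1) ^ j) * (φ ^ (j + 1) * H) := by
        rw [neg_pow]; ring
      rw [h4] at h3
      exact (IsUnit.dvd_mul_left ((hM j (by omega)).mul (isUnit_one.neg.pow j))).1 h3
    obtain ⟨c', hc'⟩ := h2
    refine ⟨e + (j + 1), ?_, c', ?_⟩
    · have : (j + 1) * (j + 1 + 1) = j * (j + 1) + (j + 1) * 2 := by ring
      rw [this, Nat.add_mul_div_right _ _ two_pos]
      omega
    · rw [pow_add]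
      linear_combination φ ^ (j + 1) * hH + L ^ j * hc'

theorem eq_zero_of_eval₂_frobenius_eq_zero [IsDomain A] {p : ℕ} [Fact p.Prime] [CharP A p] {t : A}
    (ht : D t ≠ 0) {q : A[X]} (hq : q.natDegree < p) (h : q.eval₂ (frobenius A p) t = 0) :
    q = 0 := by
  have hD : ∀ q : A[X], D (q.eval₂ (frobenius A p) t) =
      q.derivative.eval₂ (frobenius A p) t * D t := by
    intro q
    induction q using Polynomial.induction_on' with
    | add a b ha hb => simp [ha, hb, add_mul]
    | monomial n a =>
      rw [derivative_monomial, eval₂_monomial, eval₂_monomial, D.leibniz, D.leibniz_pow]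
      rw [map_mul, map_natCast, frobenius_def, D.leibniz_pow]
      simp
      ring
  induction hn : q.natDegree using Nat.strong_induction_on generalizing q with
  | _ n ih =>
    have hder : q.derivative = 0 := by
      by_contra hne
      have hpos : q.natDegree ≠ 0 := fun h0 => hne (derivative_of_natDegree_zero h0)
      have hlt := natDegree_derivative_lt hpos
      refine hne (ih _ (hn ▸ hlt) (hlt.trans hq) ?_ rfl)
      have := hD q
      rw [h, map_zero, eq_comm, mul_eq_zero] at this
      exact this.resolve_right ht
    have hn0 : q.natDegree = 0 := by
      by_contra hpos
      obtain ⟨m, hm⟩ := Nat.exists_eq_succ_of_ne_zero hpos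
      have h1 := congrArg (coeff · m) hder
      simp only [coeff_derivative, coeff_zero, mul_eq_zero] at h1
      rcases h1 with h1 | h1
      · rw [← Nat.succ_eq_add_one, ← hm] at h1
        exact hpos (by rw [leadingCoeff_eq_zero.1 h1, natDegree_zero])
      · have h2 : ((m + 1 : ℕ) : A) = 0 := by exact_mod_cast h1
        rw [CharP.cast_eq_zero_iff A p] at h2
        exact absurd (Nat.le_of_dvd (Nat.succ_pos m) h2) (by omega)
    rw [eq_C_of_natDegree_eq_zero hn0] at h ⊢
    rw [eval₂_C, frobenius_def] at h
    rw [pow_eq_zero_iff (Fact.out : p.Prime).ne_zero |>.1 h, C_0]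

end Multiplicity
end QuarticRing

theorem Polynomial.natDegree_det_le {R n : Type*} [CommRing R] [Fintype n] [DecidableEq n]
    {A : Matrix n n R[X]} {d : ℕ} (h : ∀ i j, (A i j).natDegree ≤ d) :
    A.det.natDegree ≤ Fintype.card n * d := by
  rw [Matrix.det_apply]
  refine natDegree_sum_le_of_forall_le _ _ fun σ _ => (natDegree_smul_le _ _).trans ?_
  refine (natDegree_prod_le _ _).trans ((Finset.sum_le_card_nsmul _ _ d fun i _ => h _ _).trans ?_)
  simp

namespace QuarticRing

theorem isDomain {F : Type*} [Field F] (h3 : (3 : F) ≠ 0) (h5 : (5 : F) ≠ 0) :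
    IsDomain (QuarticRing F) :=
  AdjoinRoot.isDomain_of_prime (quartic_irreducible h3 h5).prime

section Norm

variable {R : Type*} [CommRing R]

variable (R) in
/-- The companion matrix of `quartic R`. -/
noncomputable def companion : Matrix (Fin 4) (Fin 4) R[X] :=
  !![0, 1, 0, 0; 0, 0, 1, 0; 0, 0, 0, 1;
    -(X ^ 4 + X ^ 2 - X + 2), (X ^ 2 + X - 1) * X, 2 * (X ^ 2 + 1), 0]

/-- The matrix of multiplication by `∑ i, g i * y ^ i` on `QuarticRing R`. -/
noncomputable def mulMatrix (g : Fin 4 → R[X]) : Matrix (Fin 4) (Fin 4) R[X] :=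
  ∑ i, g i • companion R ^ (i : ℕ)

variable {S : Type*} [CommRing S] {ρ : R[X] →+* S} {s : S}

theorem companion_mulVec (h : (quartic R).eval₂ ρ s = 0) :
    (ρ.mapMatrix (companion R)).mulVec (fun i => s ^ (i : ℕ)) =
      s • fun i : Fin 4 => s ^ (i : ℕ) := by
  rw [eval₂_quartic] at h
  funext i
  fin_cases i
  · simp [companion, Matrix.mulVec, dotProduct, Fin.sum_univ_succ]
  · simp [companion, Matrix.mulVec, dotProduct, Fin.sum_univ_succ]; ring
  · simp [companion, Matrix.mulVec, dotProduct, Fin.sum_univ_succ]; ring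
  · simp [companion, Matrix.mulVec, dotProduct, Fin.sum_univ_succ, map_ofNat]
    linear_combination -h

theorem mulMatrix_mulVec (h : (quartic R).eval₂ ρ s = 0) (g : Fin 4 → R[X]) :
    (ρ.mapMatrix (mulMatrix g)).mulVec (fun i => s ^ (i : ℕ))
      = (∑ i, ρ (g i) * s ^ (i : ℕ)) • fun i : Fin 4 => s ^ (i : ℕ) := by
  have hpow : ∀ n : ℕ, (ρ.mapMatrix (companion R ^ n)).mulVec (fun i => s ^ (i : ℕ))
      = s ^ n • fun i : Fin 4 => s ^ (i : ℕ) := by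
    intro n
    induction n with
    | zero => simp
    | succ n ih =>
      rw [pow_succ, map_mul, ← Matrix.mulVec_mulVec, companion_mulVec h, Matrix.mulVec_smul, ih,
        smul_smul, pow_succ']
  have hsmul : ∀ i, ρ.mapMatrix (g i • companion R ^ (i : ℕ))
      = ρ (g i) • ρ.mapMatrix (companion R ^ (i : ℕ)) := by
    intro i
    ext
    simp
  rw [mulMatrix, map_sum, Matrix.sum_mulVec, Finset.sum_smul]
  simp only [hsmul, Matrix.smul_mulVec, hpow, smul_smul]

theorem natDegree_det_mulMatrix_le {g : Fin 4 → R[X]} {d : ℕ} (hg : ∀ i, (g i).natDegree ≤ d) :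
    (mulMatrix g).det.natDegree ≤ 4 * (d + 12) := by
  have hc : ∀ i j, (companion R i j).natDegree ≤ 4 := by
    intro i j
    fin_cases i <;> fin_cases j <;> simp [companion] <;> compute_degree <;> norm_num
  have hpow : ∀ n i j, ((companion R ^ n) i j).natDegree ≤ n * 4 := by
    intro n
    induction n with
    | zero =>
      intro i j
      rw [pow_zero, Matrix.one_apply]
      split_ifs <;> simp
    | succ n ih =>
      intro i j
      rw [pow_succ, Matrix.mul_apply]
      refine natDegree_sum_le_of_forall_le _ _ fun k _ => ?_
      rw [Nat.succ_mul]
      exact natDegree_mul_le_of_le (ih i k) (hc k j)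
  refine (natDegree_det_le (d := d + 12) fun i j => ?_).trans_eq (by simp)
  rw [mulMatrix, Matrix.sum_apply]
  refine natDegree_sum_le_of_forall_le _ _ fun k _ => ?_
  rw [Matrix.smul_apply, smul_eq_mul]
  refine (natDegree_mul_le_of_le (hg k) (hpow k i j)).trans ?_
  omega

end Norm

theorem eq_zero_of_sum_frobenius_eq_zero {p : ℕ} [Fact p.Prime] (h3 : (3 : ZMod p) ≠ 0)
    (h5 : (5 : ZMod p) ≠ 0) {D : Derivation (ZMod p) (QuarticRing (ZMod p)) (QuarticRing (ZMod p))}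
    (hD : D (x _) ≠ 0) {d : ℕ} (hd : 4 * (d + 12) < p) {g : Fin 4 → (QuarticRing (ZMod p))[X]}
    (hg : ∀ i, (g i).natDegree ≤ d)
    (h : ∑ i, (g i).eval₂ (frobenius _ p) (x _) * y _ ^ (i : ℕ) = 0) : g = 0 := by
  have := isDomain h3 h5
  let ψ := eval₂RingHom (frobenius (QuarticRing (ZMod p)) p) (x _)
  have hψX : ψ X = x _ := by simp [ψ]
  have hdet : (mulMatrix g).det = 0 := by
    refine eq_zero_of_eval₂_frobenius_eq_zero D hD
      ((natDegree_det_mulMatrix_le hg).trans_lt hd) ?_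
    have hψ : (quartic (QuarticRing (ZMod p))).eval₂ ψ (y _) = 0 := by
      rw [eval₂_quartic, hψX]
      exact relation
    have key := mulMatrix_mulVec hψ g
    have h' : ∑ i, ψ (g i) * y _ ^ (i : ℕ) = 0 := h
    rw [h', zero_smul] at key
    rw [← coe_eval₂RingHom, RingHom.map_det]
    refine Matrix.exists_mulVec_eq_zero_iff.1 ⟨_, fun h0 => ?_, key⟩
    simpa using congrFun h0 0
  let E := FractionRing (QuarticRing (ZMod p))
  have inj := IsFractionRing.injective (QuarticRing (ZMod p)) E
  have : CharP E p := charP_of_injective_algebraMap inj p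
  have inj' := (algebraMap (ZMod p) E).injective
  have : IsDomain (QuarticRing E) := isDomain
    (by simpa [map_ofNat] using (map_ne_zero_iff _ inj').2 h3)
    (by simpa [map_ofNat] using (map_ne_zero_iff _ inj').2 h5)
  let ρ : (QuarticRing (ZMod p))[X] →+* QuarticRing E :=
    (AdjoinRoot.of (quartic E)).comp (mapRingHom (algebraMap _ E))
  have hρ : (quartic (QuarticRing (ZMod p))).eval₂ ρ (y E) = 0 := by
    have hX : ρ X = x E := by simp [ρ, x]
    rw [eval₂_quartic, hX]
    exact relation
  obtain ⟨w, hw, hwg⟩ := Matrix.exists_vecMul_eq_zero_iff.2 hdet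
  have hwg' : (∑ i, ρ (w i) * y E ^ (i : ℕ)) * ∑ i, ρ (g i) * y E ^ (i : ℕ) = 0 := by
    have := congrArg (fun v => (ρ ∘ w) ⬝ᵥ v) (mulMatrix_mulVec hρ g)
    have hw0 : Matrix.vecMul (ρ ∘ w) (ρ.mapMatrix (mulMatrix g)) = 0 := by
      funext i
      rw [RingHom.mapMatrix_apply, ← RingHom.map_vecMul, hwg, Pi.zero_apply, map_zero,
        Pi.zero_apply]
    simp only [Matrix.dotProduct_mulVec, hw0, zero_dotProduct, dotProduct_smul, smul_eq_mul] at this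
    rw [mul_comm]
    exact this.symm
  have inj'' : ∀ v : Fin 4 → (QuarticRing (ZMod p))[X],
      ∑ i, ρ (v i) * y E ^ (i : ℕ) = 0 → v = 0 := by
    intro v hv
    have := eq_zero_of_sum_eq_zero (w := fun i => (v i).map (algebraMap _ E)) hv
    funext i
    exact (Polynomial.map_eq_zero_iff inj).1 (congrFun this i)
  exact inj'' g ((mul_eq_zero.1 hwg').resolve_left fun h => hw (inj'' w h))

end QuarticRing

theorem LinearMap.exists_ne_zero_map_eq_zero_of_mem {F V A κ : Type*} [Field F] [AddCommGroup V]
    [Module F V] [Module.Finite F V] [AddCommGroup A] [Module F A] [Fintype κ] (Φ : κ → V →ₗ[F] A)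
    (W : Submodule F A) [Module.Finite F W] (hΦ : ∀ k v, Φ k v ∈ W)
    (h : Fintype.card κ * Module.finrank F W < Module.finrank F V) :
    ∃ v ≠ 0, ∀ k, Φ k v = 0 := by
  let Ψ : V →ₗ[F] κ → W := LinearMap.pi fun k => (Φ k).codRestrict W (hΦ k)
  have hker : LinearMap.ker Ψ ≠ ⊥ := by
    refine LinearMap.ker_ne_bot_of_finrank_lt ?_
    simpa [Module.finrank_pi_fintype] using h
  obtain ⟨v, hv, hv0⟩ := Submodule.exists_mem_ne_zero_of_ne_bot hker
  refine ⟨v, hv0, fun k => ?_⟩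
  have := congrArg (fun w : κ → W => (w k : A)) (LinearMap.mem_ker.1 hv)
  simpa [Ψ] using this

namespace QuarticRing

section DerivationDegree

variable {F : Type*} [Field F]

theorem fy_mem_degLE : (fy : QuarticRing F) ∈ degLE F 3 := by
  have h1 := monomial_mem_degLE (F := F) (a := 0) (b := 3) (d := 3) (by norm_num)
  have h2 := monomial_mem_degLE (F := F) (a := 2) (b := 1) (d := 3) (by norm_num)
  have h3 := monomial_mem_degLE (F := F) (a := 0) (b := 1) (d := 3) (by norm_num)
  have h4 := monomial_mem_degLE (F := F) (a := 3) (b := 0) (d := 3) (by norm_num)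
  have h5 := monomial_mem_degLE (F := F) (a := 2) (b := 0) (d := 3) (by norm_num)
  have h6 := monomial_mem_degLE (F := F) (a := 1) (b := 0) (d := 3) (by norm_num)
  convert add_mem (sub_mem (sub_mem (sub_mem (sub_mem (Submodule.smul_mem _ (4 : F) h1)
    (Submodule.smul_mem _ (4 : F) h2)) (Submodule.smul_mem _ (4 : F) h3)) h4) h5) h6 using 1
  simp only [fy, Algebra.smul_def, map_ofNat]
  ring

theorem fx_mem_degLE : (fx : QuarticRing F) ∈ degLE F 3 := by
  have h1 := monomial_mem_degLE (F := F) (a := 3) (b := 0) (d := 3) (by norm_num)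
  have h2 := monomial_mem_degLE (F := F) (a := 1) (b := 0) (d := 3) (by norm_num)
  have h3 := monomial_mem_degLE (F := F) (a := 0) (b := 0) (d := 3) (by norm_num)
  have h4 := monomial_mem_degLE (F := F) (a := 1) (b := 2) (d := 3) (by norm_num)
  have h5 := monomial_mem_degLE (F := F) (a := 2) (b := 1) (d := 3) (by norm_num)
  have h6 := monomial_mem_degLE (F := F) (a := 1) (b := 1) (d := 3) (by norm_num)
  have h7 := monomial_mem_degLE (F := F) (a := 0) (b := 1) (d := 3) (by norm_num)
  convert add_mem (sub_mem (sub_mem (sub_mem (sub_mem (add_mem (Submodule.smul_mem _ (4 : F) h1)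
    (Submodule.smul_mem _ (2 : F) h2)) h3) (Submodule.smul_mem _ (4 : F) h4))
    (Submodule.smul_mem _ (3 : F) h5)) (Submodule.smul_mem _ (2 : F) h6)) h7 using 1
  simp only [fx, Algebra.smul_def, map_ofNat]
  ring

theorem fy_ne_zero (h : (4 : F) ≠ 0) : (fy : QuarticRing F) ≠ 0 := by
  intro h0
  have h1 := eq_zero_of_sum_eq_zero (R := F)
    (w := ![-((X ^ 2 + X - 1) * X), -(4 * (X ^ 2 + 1)), 0, C 4]) (by
      rw [← h0]
      simp [Fin.sum_univ_succ, fy, x, map_ofNat]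
      ring)
  exact h (C_eq_zero.1 (congrFun h1 3))

theorem derivation_mem_degLE {D : Derivation F (QuarticRing F) (QuarticRing F)}
    (hx : D (x F) = fy) (hy : D (y F) = -fx) {d : ℕ} {z : QuarticRing F} (hz : z ∈ degLE F d) :
    D z ∈ degLE F (d + 2) := by
  have h : degLE F d ≤ (degLE F (d + 2)).comap D.toLinearMap := by
    refine Submodule.span_le.2 ?_
    rintro _ ⟨a, b, hab, rfl⟩
    change D (x F ^ a * y F ^ b) ∈ degLE F (d + 2)
    rw [D.leibniz, D.leibniz_pow, D.leibniz_pow, hx, hy]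
    simp only [smul_eq_mul, mul_smul_comm]
    refine add_mem ?_ ?_
    · rcases b with _ | b
      · simp
      · rw [← mul_assoc]
        exact nsmul_mem (degLE_mono (by omega) (mul_mem_degLE
          (monomial_mem_degLE (F := F) (d := a + b) le_rfl) (neg_mem fx_mem_degLE))) _
    · rcases a with _ | a
      · simp
      · rw [← mul_assoc, mul_comm (y F ^ b)]
        exact nsmul_mem (degLE_mono (by omega) (mul_mem_degLE
          (monomial_mem_degLE (F := F) (d := a + b) le_rfl) fy_mem_degLE)) _
  exact h hz

theorem iterate_derivation_mem_degLE {D : Derivation F (QuarticRing F) (QuarticRing F)}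
    (hx : D (x F) = fy) (hy : D (y F) = -fx) {d : ℕ} {z : QuarticRing F} (hz : z ∈ degLE F d)
    (m : ℕ) : D^[m] z ∈ degLE F (d + 2 * m) := by
  induction m with
  | zero => exact hz
  | succ m ih =>
    rw [Function.iterate_succ_apply']
    exact derivation_mem_degLE hx hy ih

end DerivationDegree

section Auxiliary

variable {F : Type*} [Field F] {K J : ℕ}

/-- The coefficient function `∑ c x ^ a y ^ i` of the auxiliary function at `(x ^ j y ^ l) ^ p`. -/
noncomputable def auxCoeff (F : Type*) [Field F] (K J : ℕ) (j : Fin J) (l : Fin 4) :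
    (Fin J × Fin 4 × Fin K × Fin 4 → F) →ₗ[F] QuarticRing F :=
  ∑ a : Fin K, ∑ i : Fin 4,
    (LinearMap.proj (j, l, a, i)).smulRight (x F ^ (a : ℕ) * y F ^ (i : ℕ))

/-- The auxiliary function `∑ c x ^ a y ^ i (x ^ j y ^ l) ^ p`. -/
noncomputable def auxFun (p : ℕ) (c : Fin J × Fin 4 × Fin K × Fin 4 → F) : QuarticRing F :=
  ∑ j : Fin J, ∑ l : Fin 4, (x F ^ (j : ℕ) * y F ^ (l : ℕ)) ^ p * auxCoeff F K J j l c

theorem auxCoeff_apply (j : Fin J) (l : Fin 4) (c : Fin J × Fin 4 × Fin K × Fin 4 → F) :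
    auxCoeff F K J j l c = ∑ a, ∑ i, c (j, l, a, i) • (x F ^ (a : ℕ) * y F ^ (i : ℕ)) := by
  simp [auxCoeff]

theorem auxCoeff_mem_degLE (j : Fin J) (l : Fin 4) (c : Fin J × Fin 4 × Fin K × Fin 4 → F) :
    auxCoeff F K J j l c ∈ degLE F (K + 2) := by
  rw [auxCoeff_apply]
  exact sum_mem fun a _ => sum_mem fun i _ =>
    Submodule.smul_mem _ _ (monomial_mem_degLE (by omega))

theorem auxFun_mem_degLE (p : ℕ) (c : Fin J × Fin 4 × Fin K × Fin 4 → F) :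
    auxFun p c ∈ degLE F (p * (J + 2) + (K + 2)) :=
  sum_mem fun j _ => sum_mem fun l _ => mul_mem_degLE
    (pow_mem_degLE (monomial_mem_degLE (by omega : (j : ℕ) + l ≤ J + 2)) _)
    (auxCoeff_mem_degLE j l c)

/-- The part of the `m`-th derivative of the auxiliary function that multiplies `(y ^ p) ^ l`,
with `x ^ p` replaced by `x`. -/
noncomputable def auxDeriv (D : Derivation F (QuarticRing F) (QuarticRing F)) (m : ℕ) (l : Fin 4) :
    (Fin J × Fin 4 × Fin K × Fin 4 → F) →ₗ[F] QuarticRing F :=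
  ∑ j : Fin J, LinearMap.mulLeft F (x F ^ (j : ℕ)) ∘ₗ (D.toLinearMap ^ m) ∘ₗ auxCoeff F K J j l

theorem auxDeriv_apply (D : Derivation F (QuarticRing F) (QuarticRing F)) (m : ℕ) (l : Fin 4)
    (c : Fin J × Fin 4 × Fin K × Fin 4 → F) :
    auxDeriv D m l c = ∑ j : Fin J, x F ^ (j : ℕ) * D^[m] (auxCoeff F K J j l c) := by
  simp [auxDeriv, Module.End.pow_apply]

theorem exists_auxDeriv_eq {D : Derivation F (QuarticRing F) (QuarticRing F)}
    (hx : D (x F) = fy) (hy : D (y F) = -fx) {q : Fin 3 → QuarticRing F}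
    (hq : ∀ r, q r ∈ degLE F 3) {M : ℕ} (h : 12 * M * (K + J + 2 * M + 3) < 16 * (K * J)) :
    ∃ c : Fin J × Fin 4 × Fin K × Fin 4 → F, c ≠ 0 ∧
      ∀ m < M, ∀ r, auxDeriv D m r.castSucc c = q r * auxDeriv D m 3 c := by
  let Φ : Fin M × Fin 3 → (Fin J × Fin 4 × Fin K × Fin 4 → F) →ₗ[F] QuarticRing F := fun k =>
    auxDeriv D k.1 k.2.castSucc - LinearMap.mulLeft F (q k.2) ∘ₗ auxDeriv D k.1 3
  have hz : ∀ m < M, ∀ l (c : Fin J × Fin 4 × Fin K × Fin 4 → F),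
      auxDeriv D m l c ∈ degLE F (K + J + 2 * M - 1) := by
    intro m hm l c
    rw [auxDeriv_apply]
    refine sum_mem fun j _ => degLE_mono ?_ (mul_mem_degLE (pow_mem_degLE x_mem_degLE _)
      (iterate_derivation_mem_degLE hx hy (auxCoeff_mem_degLE j l c) m))
    omega
  obtain ⟨c, hc, h0⟩ := LinearMap.exists_ne_zero_map_eq_zero_of_mem Φ
    (degLE F (K + J + 2 * M + 2)) (fun k c => by
      refine sub_mem (degLE_mono (by omega) (hz k.1 k.1.2 _ c)) (degLE_mono ?_
        (mul_mem_degLE (hq k.2) (hz k.1 k.1.2 3 c)))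
      have := k.1.2
      omega) (by
      refine (Nat.mul_le_mul_left _ (finrank_degLE_le _)).trans_lt ?_
      simp only [Module.finrank_fintype_fun_eq_card, Fintype.card_prod, Fintype.card_fin]
      linarith)
  exact ⟨c, hc, fun m hm r => sub_eq_zero.1 (h0 (⟨m, hm⟩, r))⟩

end Auxiliary

section Stepanov

variable {p : ℕ} [Fact p.Prime] {K J : ℕ}
  {D : Derivation (ZMod p) (QuarticRing (ZMod p)) (QuarticRing (ZMod p))}

theorem iterate_derivation_pow_mul (m : ℕ) (a b : QuarticRing (ZMod p)) :
    D^[m] (a ^ p * b) = a ^ p * D^[m] b := by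
  induction m with
  | zero => rfl
  | succ m ih =>
    rw [Function.iterate_succ_apply', Function.iterate_succ_apply', ih, D.leibniz, D.leibniz_pow]
    simp

theorem dvd_iterate_auxFun_sub (m : ℕ) (c : Fin J × Fin 4 × Fin K × Fin 4 → ZMod p) :
    x (ZMod p) ^ p - x _ ∣
      D^[m] (auxFun p c) - ∑ l : Fin 4, auxDeriv D m l c * (y _ ^ p) ^ (l : ℕ) := by
  have h1 : D^[m] (auxFun p c) = ∑ l : Fin 4, ∑ j : Fin J,
      (x _ ^ (j : ℕ) * y _ ^ (l : ℕ)) ^ p * D^[m] (auxCoeff _ K J j l c) := by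
    have hl : ∀ z : QuarticRing (ZMod p), D^[m] z = (D.toLinearMap ^ m) z := fun z => by
      simp [Module.End.pow_apply]
    rw [auxFun, Finset.sum_comm, hl, map_sum (D.toLinearMap ^ m)]
    simp only [map_sum (D.toLinearMap ^ m), ← hl, iterate_derivation_pow_mul]
  rw [h1, ← Finset.sum_sub_distrib]
  refine Finset.dvd_sum fun l _ => ?_
  rw [auxDeriv_apply, Finset.sum_mul, ← Finset.sum_sub_distrib]
  refine Finset.dvd_sum fun j _ => ?_
  obtain ⟨e, he⟩ := sub_dvd_pow_sub_pow (x (ZMod p) ^ p) (x _) j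
  refine ⟨e * y _ ^ (p * l) * D^[m] (auxCoeff _ K J j l c), ?_⟩
  rw [mul_pow, pow_right_comm, ← pow_mul, ← pow_mul, mul_comm (l : ℕ), ← mul_assoc, ← mul_assoc, ← he,
    pow_mul]
  ring

theorem sum_sum_comm_sum_sum {ι₁ ι₂ ι₃ ι₄ A : Type*} [Fintype ι₁] [Fintype ι₂] [Fintype ι₃]
    [Fintype ι₄] [AddCommMonoid A] (t : ι₁ → ι₂ → ι₃ → ι₄ → A) :
    ∑ i, ∑ a, ∑ j, ∑ l, t i a j l = ∑ j, ∑ l, ∑ a, ∑ i, t i a j l := by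
  calc ∑ i, ∑ a, ∑ j, ∑ l, t i a j l = ∑ a, ∑ i, ∑ j, ∑ l, t i a j l := Finset.sum_comm
    _ = ∑ a, ∑ j, ∑ l, ∑ i, t i a j l := Finset.sum_congr rfl fun a _ => by
      rw [Finset.sum_comm]
      exact Finset.sum_congr rfl fun j _ => Finset.sum_comm
    _ = ∑ j, ∑ l, ∑ a, ∑ i, t i a j l := by
      rw [Finset.sum_comm]
      exact Finset.sum_congr rfl fun j _ => Finset.sum_comm

theorem auxFun_ne_zero (h3 : (3 : ZMod p) ≠ 0) (h5 : (5 : ZMod p) ≠ 0)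
    (hD : D (x _) ≠ 0) (hK : 4 * (K + 11) < p)
    {c : Fin J × Fin 4 × Fin K × Fin 4 → ZMod p} (hc : c ≠ 0) : auxFun p c ≠ 0 := by
  intro h0
  have hK0 : K ≠ 0 := by
    rintro rfl
    exact hc (Subsingleton.elim _ _)
  let γ : Fin K → Fin 4 → QuarticRing (ZMod p) := fun a i =>
    ∑ j, ∑ l, c (j, l, a, i) • (x _ ^ (j : ℕ) * y _ ^ (l : ℕ))
  let g : Fin 4 → (QuarticRing (ZMod p))[X] := fun i => ∑ a, C (γ a i) * X ^ (a : ℕ)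
  have hg : g = 0 := by
    refine eq_zero_of_sum_frobenius_eq_zero h3 h5 hD (d := K - 1) (by omega) (fun i => ?_) ?_
    · refine natDegree_sum_le_of_forall_le _ _ fun a _ => (natDegree_C_mul_X_pow_le _ _).trans ?_
      omega
    · rw [← h0]
      simp only [g, γ, eval₂_finsetSum, eval₂_mul, eval₂_C, eval₂_X_pow, map_sum, frobenius_def,
        _root_.smul_pow, ZMod.pow_card, auxFun, auxCoeff_apply, Finset.sum_mul, Finset.mul_sum,
        smul_mul_assoc, mul_smul_comm]
      rw [sum_sum_comm_sum_sum]
      simp only [mul_assoc]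
  refine hc (funext fun ⟨j, l, a, i⟩ => ?_)
  have hγ : γ a i = 0 := by
    have := congrArg (coeff · (a : ℕ)) (congrFun hg i)
    simpa [g, coeff_C_mul_X_pow, Fin.val_inj] using this
  have hw := eq_zero_of_sum_eq_zero (R := ZMod p)
    (w := fun l => ∑ j : Fin J, C (c (j, l, a, i)) * X ^ (j : ℕ)) (by
      rw [← hγ]
      simp only [γ, of_eq_aeval]
      rw [Finset.sum_comm]
      simp [Finset.sum_mul, Algebra.smul_def, mul_assoc])
  have := congrArg (coeff · (j : ℕ)) (congrFun hw l)
  simpa [coeff_C_mul_X_pow, Fin.val_inj] using this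

/-- Over a large prime field the affine quartic has a point at which the derivative with respect to
`y` does not vanish. The proof is Stepanov's: were there none, the auxiliary function would vanish
to high order at all points over rational values of `x`, exceeding its degree. -/
theorem exists_eq_zero_and_ne_zero (hp : 1777 ≤ p) :
    ∃ a b : ZMod p, b ^ 4 - 2 * (a ^ 2 + 1) * b ^ 2 - (a ^ 2 + a - 1) * a * b
      + (a ^ 4 + a ^ 2 - a + 2) = 0 ∧
      4 * b ^ 3 - 4 * (a ^ 2 + 1) * b - (a ^ 2 + a - 1) * a ≠ 0 := by
  by_contra! H
  have hprime : p.Prime := Fact.out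
  have hcast : ∀ n : ℕ, 0 < n → n < p → (n : ZMod p) ≠ 0 := fun n hn hnp h0 =>
    absurd (Nat.le_of_dvd hn ((ZMod.natCast_eq_zero_iff n p).1 h0)) (by omega)
  have h3 : (3 : ZMod p) ≠ 0 := by exact_mod_cast hcast 3 (by norm_num) (by omega)
  have h4 : (4 : ZMod p) ≠ 0 := by exact_mod_cast hcast 4 (by norm_num) (by omega)
  have h5 : (5 : ZMod p) ≠ 0 := by exact_mod_cast hcast 5 (by norm_num) (by omega)
  have := isDomain h3 h5
  have hfy := fy_ne_zero h4
  obtain ⟨D, hDx, hDy⟩ := exists_derivation (R := ZMod p)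
  let q : Fin 3 → QuarticRing (ZMod p) :=
    ![y _ ^ 3 - 2 * (x _ ^ 2 + 1) * y _ - (x _ ^ 2 + x _ - 1) * x _,
      y _ ^ 2 - 2 * (x _ ^ 2 + 1), y _]
  have hq : ∀ r, q r ∈ degLE (ZMod p) 3 := by
    have h1 := monomial_mem_degLE (F := ZMod p) (a := 0) (b := 3) (d := 3) (by norm_num)
    have h2 := monomial_mem_degLE (F := ZMod p) (a := 2) (b := 1) (d := 3) (by norm_num)
    have h3 := monomial_mem_degLE (F := ZMod p) (a := 0) (b := 1) (d := 3) (by norm_num)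
    have h4 := monomial_mem_degLE (F := ZMod p) (a := 3) (b := 0) (d := 3) (by norm_num)
    have h5 := monomial_mem_degLE (F := ZMod p) (a := 2) (b := 0) (d := 3) (by norm_num)
    have h6 := monomial_mem_degLE (F := ZMod p) (a := 1) (b := 0) (d := 3) (by norm_num)
    have h7 := monomial_mem_degLE (F := ZMod p) (a := 0) (b := 2) (d := 3) (by norm_num)
    have h8 := monomial_mem_degLE (F := ZMod p) (a := 0) (b := 0) (d := 3) (by norm_num)
    rw [Fin.forall_fin_succ, Fin.forall_fin_two]
    refine ⟨?_, ?_, ?_⟩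
    · convert add_mem (sub_mem (sub_mem (sub_mem (sub_mem h1
        (Submodule.smul_mem _ (2 : ZMod p) h2)) (Submodule.smul_mem _ (2 : ZMod p) h3)) h4) h5) h6
        using 1
      simp only [q, Algebra.smul_def, map_ofNat, Matrix.cons_val_zero]
      ring
    · convert sub_mem (sub_mem h7 (Submodule.smul_mem _ (2 : ZMod p) h5))
        (Submodule.smul_mem _ (2 : ZMod p) h8) using 1
      simp [q, Algebra.smul_def, map_ofNat]
      ring
    · simpa [q] using h3
  obtain ⟨K, J, M, hM, hMp, hKp, hdegree⟩ : ∃ K J M : ℕ,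
      12 * M * (K + J + 2 * M + 3) < 16 * (K * J) ∧
      M ≤ p ∧ 4 * (K + 11) < p ∧ ∀ e ≤ M * (M + 1) / 2, e * 3 + (p * (J + 2) + (K + 2)) < p * M :=
    ⟨433, 22, 25, by norm_num, by omega, by omega, fun e he => by omega⟩
  obtain ⟨c, hc, hrel⟩ := exists_auxDeriv_eq (K := K) (J := J) (M := M) hDx hDy hq hM
  set L : QuarticRing (ZMod p) := x _ ^ p - x _ with hL
  have hdvd : ∀ m < M, L ∣ fy * D^[m] (auxFun p c) := by
    intro m hm
    have h1 := (dvd_iterate_auxFun_sub (D := D) m c).mul_left fy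
    have h2 := (dvd_fy_mul H).mul_right (auxDeriv D m 3 c)
    rw [← hL] at h1 h2
    have e0 : auxDeriv D m 0 c = q 0 * auxDeriv D m 3 c := hrel m hm 0
    have e1 : auxDeriv D m 1 c = q 1 * auxDeriv D m 3 c := hrel m hm 1
    have e2 : auxDeriv D m 2 c = q 2 * auxDeriv D m 3 c := hrel m hm 2
    convert dvd_add h1 h2 using 1
    rw [Fin.sum_univ_four, e0, e1, e2]
    simp [q]
    ring
  have hDL : D L = -fy := by
    rw [hL, map_sub, D.leibniz_pow, hDx]
    simp
  obtain ⟨e, he, hpow⟩ := pow_dvd_of_dvd_iterate D hDL (M := M) (fun j hj => by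
    rw [← map_natCast (algebraMap (ZMod p) (QuarticRing (ZMod p)))]
    refine (IsUnit.mk0 _ fun h0 => ?_).map _
    have h1 := (hprime.dvd_factorial).1 ((ZMod.natCast_eq_zero_iff _ p).1 h0)
    omega) hdvd
  have hzero := eq_zero_of_dvd_of_mem_degLE
    (mul_mem_degLE (pow_mem_degLE fy_mem_degLE e) (auxFun_mem_degLE p c)) (l := (X ^ p - X) ^ M) (by
      rw [natDegree_pow, FiniteField.X_pow_card_sub_X_natDegree_eq _ hprime.one_lt, mul_comm M]
      exact hdegree e he) (by simpa [hL, x] using hpow)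
  exact (mul_ne_zero (pow_ne_zero e hfy) (auxFun_ne_zero (D := D) h3 h5 (by rwa [hDx]) hKp hc))
    hzero

end Stepanov

end QuarticRing

/-- Triples `(p, x, y)` such that `(x, y)` is a point modulo `p` of the affine quartic at which the
derivative with respect to `y` does not vanish, one for each prime `3 ≤ p < 1777`. -/
def smallPrimePoints : List (ℕ × ℕ × ℕ) :=
  [(3, 1, 0), (5, 4, 0), (7, 4, 4), (11, 4, 7), (13, 0, 3), (17, 4, 12), (19, 2, 4), (23, 4, 1),
    (29, 4, 9), (31, 1, 7), (37, 3, 1), (41, 3, 2), (43, 4, 7), (47, 4, 10), (53, 1, 10),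
    (59, 1, 8), (61, 4, 3), (67, 4, 5), (71, 1, 7), (73, 1, 15), (79, 2, 24), (83, 3, 40),
    (89, 3, 0), (97, 4, 39), (101, 0, 30), (103, 1, 67), (107, 3, 4), (109, 3, 3), (113, 0, 4),
    (127, 1, 51), (131, 3, 15), (137, 4, 42), (139, 3, 8), (149, 4, 12), (151, 3, 45),
    (157, 3, 27), (163, 1, 25), (167, 1, 113), (173, 0, 9), (179, 2, 124), (181, 1, 10),
    (191, 1, 4), (193, 2, 17), (197, 0, 58), (199, 4, 47), (211, 4, 148), (223, 2, 10),
    (227, 1, 15), (229, 0, 32), (233, 1, 22), (239, 3, 136), (241, 4, 138), (251, 1, 99),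
    (257, 0, 70), (263, 2, 38), (269, 0, 69), (271, 4, 27), (277, 1, 58), (281, 2, 139),
    (283, 2, 8), (293, 0, 50), (307, 3, 184), (311, 4, 33), (313, 0, 17), (317, 0, 134),
    (331, 4, 26), (337, 2, 29), (347, 2, 28), (349, 3, 15), (353, 2, 34), (359, 2, 84),
    (367, 3, 29), (373, 4, 40), (379, 4, 122), (383, 1, 6), (389, 1, 53), (397, 0, 8),
    (401, 4, 15), (409, 0, 12), (419, 2, 117), (421, 4, 71), (431, 1, 43), (433, 3, 128),
    (439, 3, 136), (443, 3, 195), (449, 1, 342), (457, 0, 32), (461, 0, 7), (463, 4, 352),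
    (467, 3, 6), (479, 2, 60), (487, 3, 94), (491, 2, 174), (499, 1, 143), (503, 1, 176),
    (509, 0, 154), (521, 0, 211), (523, 1, 5), (541, 0, 222), (547, 3, 96), (557, 0, 26),
    (563, 2, 344), (569, 0, 22), (571, 1, 54), (577, 0, 5), (587, 2, 35), (593, 1, 29),
    (599, 3, 143), (601, 1, 334), (607, 2, 222), (613, 0, 6), (617, 4, 504), (619, 1, 197),
    (631, 3, 151), (641, 4, 143), (643, 3, 203), (647, 2, 134), (653, 4, 26), (659, 2, 82),
    (661, 1, 177), (673, 4, 14), (677, 0, 130), (683, 2, 16), (691, 2, 29), (701, 3, 49),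
    (709, 0, 166), (719, 2, 94), (727, 3, 203), (733, 0, 152), (739, 1, 78), (743, 2, 81),
    (751, 1, 423), (757, 2, 14), (761, 0, 83), (769, 3, 150), (773, 4, 145), (787, 4, 86),
    (797, 0, 240), (809, 3, 76), (811, 2, 192), (821, 4, 134), (823, 2, 131), (827, 2, 123),
    (829, 3, 38), (839, 1, 413), (853, 3, 82), (857, 0, 89), (859, 3, 180), (863, 4, 115),
    (877, 2, 174), (881, 0, 70), (883, 3, 81), (887, 4, 238), (907, 4, 184), (911, 2, 57),
    (919, 3, 11), (929, 2, 118), (937, 4, 200), (941, 0, 269), (947, 1, 57), (953, 0, 248),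
    (967, 4, 61), (971, 3, 134), (977, 2, 575), (983, 2, 258), (991, 4, 88), (997, 1, 22),
    (1009, 4, 66), (1013, 0, 159), (1019, 3, 145), (1021, 2, 93), (1031, 2, 24), (1033, 3, 461),
    (1039, 3, 410), (1049, 4, 47), (1051, 1, 102), (1061, 1, 179), (1063, 2, 263), (1069, 0, 149),
    (1087, 3, 35), (1091, 4, 61), (1093, 2, 104), (1097, 3, 98), (1103, 4, 322), (1109, 4, 39),
    (1117, 3, 186), (1123, 3, 99), (1129, 0, 13), (1151, 1, 31), (1153, 0, 60), (1163, 4, 13),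
    (1171, 3, 72), (1181, 3, 87), (1187, 1, 29), (1193, 2, 177), (1201, 2, 188), (1213, 0, 81),
    (1217, 1, 35), (1223, 4, 175), (1229, 4, 33), (1231, 4, 577), (1237, 1, 57), (1249, 0, 139),
    (1259, 2, 1165), (1277, 0, 119), (1279, 3, 7), (1283, 2, 106), (1289, 2, 148), (1291, 3, 218),
    (1297, 2, 134), (1301, 0, 250), (1303, 4, 58), (1307, 2, 67), (1319, 1, 161), (1321, 0, 149),
    (1327, 4, 215), (1361, 2, 1216), (1367, 1, 307), (1373, 2, 411), (1381, 0, 89),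
    (1399, 3, 147), (1409, 2, 858), (1423, 4, 11), (1427, 4, 75), (1429, 2, 40), (1433, 1, 169),
    (1439, 3, 982), (1447, 4, 177), (1451, 1, 74), (1453, 0, 96), (1459, 2, 243), (1471, 2, 777),
    (1481, 2, 314), (1483, 3, 611), (1487, 1, 1408), (1489, 4, 600), (1493, 3, 350),
    (1499, 1, 213), (1511, 1, 241), (1523, 3, 105), (1531, 2, 145), (1543, 3, 267),
    (1549, 0, 315), (1553, 0, 265), (1559, 1, 27), (1567, 3, 1214), (1571, 2, 456),
    (1579, 3, 169), (1583, 1, 43), (1597, 0, 626), (1601, 4, 19), (1607, 1, 507), (1609, 2, 59),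
    (1613, 0, 605), (1619, 4, 195), (1621, 3, 16), (1627, 1, 355), (1637, 3, 704), (1657, 0, 28),
    (1663, 1, 1447), (1667, 2, 636), (1669, 3, 58), (1693, 4, 232), (1697, 3, 543),
    (1699, 4, 502), (1709, 4, 149), (1721, 3, 183), (1723, 1, 1165), (1733, 0, 240),
    (1741, 1, 114), (1747, 2, 353), (1753, 2, 113), (1759, 4, 738)]

theorem smallPrimePoints_spec : ∀ t ∈ smallPrimePoints,
    (t.2.2 ^ 4 + t.2.1 ^ 4 + t.2.1 ^ 2 + 2 + t.2.1 * t.2.2) % t.1 =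
      (2 * (t.2.1 ^ 2 + 1) * t.2.2 ^ 2 + (t.2.1 ^ 3 + t.2.1 ^ 2) * t.2.2 + t.2.1) % t.1 ∧
    (4 * t.2.2 ^ 3 + t.2.1) % t.1 ≠
      (4 * (t.2.1 ^ 2 + 1) * t.2.2 + t.2.1 ^ 3 + t.2.1 ^ 2) % t.1 := by
  decide +kernel

theorem exists_dvd_or_mem_smallPrimePoints : ∀ p < 1777, 3 ≤ p →
    (∃ d ∈ [2, 3, 5, 7, 11, 13, 17, 19, 23, 29, 31, 37, 41], d < p ∧ d ∣ p) ∨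
      ∃ t ∈ smallPrimePoints, t.1 = p := by
  decide +kernel

theorem ZMod.exists_quartic_eq_zero_and_ne_zero (p : ℕ) [Fact p.Prime] (hp : 3 ≤ p) :
    ∃ a b : ZMod p, b ^ 4 - 2 * (a ^ 2 + 1) * b ^ 2 - (a ^ 2 + a - 1) * a * b
      + (a ^ 4 + a ^ 2 - a + 2) = 0 ∧
      4 * b ^ 3 - 4 * (a ^ 2 + 1) * b - (a ^ 2 + a - 1) * a ≠ 0 := by
  rcases le_or_gt 1777 p with h | h
  · exact QuarticRing.exists_eq_zero_and_ne_zero h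
  have hprime : p.Prime := Fact.out
  rcases exists_dvd_or_mem_smallPrimePoints p h hp with ⟨d, hdL, hdp, hd⟩ | ⟨⟨p, x, y⟩, ht, rfl⟩
  · have hd1 : d ≠ 1 := by
      rintro rfl
      simp at hdL
    exact absurd ((Nat.dvd_prime hprime).1 hd) (by omega)
  · obtain ⟨h0, h1⟩ := smallPrimePoints_spec _ ht
    dsimp only at *
    refine ⟨x, y, ?_, fun h2 => h1 ((ZMod.natCast_eq_natCast_iff' _ _ p).1 ?_)⟩
    · have := (ZMod.natCast_eq_natCast_iff' _ _ p).2 h0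
      push_cast at this
      linear_combination this
    · push_cast
      linear_combination h2

theorem PadicInt.exists_root_of_dvd {p : ℕ} [Fact p.Prime] {f : ℤ[X]} {a : ℤ}
    (h0 : ((f.eval a : ℤ) : ZMod p) = 0) (h1 : ((f.derivative.eval a : ℤ) : ZMod p) ≠ 0) :
    ∃ z : ℤ_[p], aeval z f = 0 := by
  have haeval : ∀ g : ℤ[X], aeval (a : ℤ_[p]) g = ((g.eval a : ℤ) : ℤ_[p]) := fun g => by
    simpa using aeval_algebraMap_apply_eq_algebraMap_eval (A := ℤ_[p]) a g
  have hd : ‖((f.derivative.eval a : ℤ) : ℤ_[p])‖ = 1 :=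
    (PadicInt.norm_le_one _).antisymm <| not_lt.1 fun h => h1 <|
      (ZMod.intCast_zmod_eq_zero_iff_dvd _ p).2 (PadicInt.norm_intCast_lt_one_iff.1 h)
  obtain ⟨z, hz, -⟩ := hensels_lemma (F := f) (a := (a : ℤ_[p])) (by
    rw [haeval, haeval, hd, one_pow]
    exact PadicInt.norm_intCast_lt_one_iff.2 ((ZMod.intCast_zmod_eq_zero_iff_dvd _ p).1 h0))
  exact ⟨z, hz⟩

theorem PadicInt.exists_quartic_eq_zero (p : ℕ) [Fact p.Prime] :
    ∃ a b : ℤ_[p], b ^ 4 - 2 * (a ^ 2 + 1) * b ^ 2 - (a ^ 2 + a - 1) * a * b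
      + (a ^ 4 + a ^ 2 - a + 2) = 0 := by
  rcases (Fact.out : p.Prime).eq_two_or_odd' with rfl | hodd
  · obtain ⟨z, hz⟩ := PadicInt.exists_root_of_dvd (p := 2) (f := X ^ 4 + X ^ 2 - X + 2) (a := 0)
      (by simp; rfl) (by simp)
    refine ⟨z, 0, ?_⟩
    simp only [map_add, map_sub, map_pow, aeval_X, map_ofNat] at hz
    linear_combination hz
  · obtain ⟨a, b, h0, h1⟩ := ZMod.exists_quartic_eq_zero_and_ne_zero p (by
      have := (Fact.out : p.Prime).two_le
      rcases hodd with ⟨k, rfl⟩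
      omega)
    obtain ⟨a, rfl⟩ := ZMod.intCast_surjective a
    obtain ⟨b, rfl⟩ := ZMod.intCast_surjective b
    obtain ⟨z, hz⟩ := PadicInt.exists_root_of_dvd (p := p)
      (f := X ^ 4 - C (2 * (a ^ 2 + 1)) * X ^ 2 - C ((a ^ 2 + a - 1) * a) * X
        + C (a ^ 4 + a ^ 2 - a + 2)) (a := b) (by
        rw [← h0]
        simp) (by
        convert h1 using 1
        simp only [derivative_add, derivative_sub, derivative_C_mul, derivative_C, derivative_X_pow,
          derivative_X, eval_add, eval_sub, eval_mul, eval_C, eval_pow, eval_X, eval_one, eval_zero]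
        push_cast
        ring)
    refine ⟨a, z, ?_⟩
    rw [← hz]
    simp [map_ofNat]

/-- The plane quartic `(v² + vw − w²)(uv + w²) = (u² − v² − w²)²` has points
over ℝ and over ℚ_p for every prime p. -/
theorem quartic_has_points_everywhere_locally :
    (∃ u v w : ℝ, ¬(u = 0 ∧ v = 0 ∧ w = 0) ∧
      (v ^ 2 + v * w - w ^ 2) * (u * v + w ^ 2) = (u ^ 2 - v ^ 2 - w ^ 2) ^ 2) ∧
    ∀ (p : ℕ) [Fact p.Prime],
      ∃ u v w : ℚ_[p], ¬(u = 0 ∧ v = 0 ∧ w = 0) ∧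
        (v ^ 2 + v * w - w ^ 2) * (u * v + w ^ 2) = (u ^ 2 - v ^ 2 - w ^ 2) ^ 2 := by
  refine ⟨⟨√(((-1 + √5) / 2) ^ 2 + 1), (-1 + √5) / 2, 1, by simp, ?_⟩, fun p _ => ?_⟩
  · have h1 : √(((-1 + √5) / 2) ^ 2 + 1) ^ 2 = ((-1 + √5) / 2) ^ 2 + 1 :=
      Real.sq_sqrt (by positivity)
    have h2 : √5 ^ 2 = (5 : ℝ) := Real.sq_sqrt (by norm_num)
    have h3 : ((-1 + √5) / 2) ^ 2 + (-1 + √5) / 2 * 1 - 1 ^ 2 = 0 := by linear_combination h2 / 4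
    rw [h1, h3]
    ring
  · obtain ⟨a, b, h⟩ := PadicInt.exists_quartic_eq_zero p
    refine ⟨PadicInt.Coe.ringHom b, PadicInt.Coe.ringHom a, 1, by simp, ?_⟩
    have h' := congrArg PadicInt.Coe.ringHom h
    simp only [map_add, map_sub, map_mul, map_pow, map_one, map_ofNat, map_zero] at h'
    linear_combination -h'
end

section
/- The projective curve D in P⁴ over ℚ defined by the three equations v² + vw − w² = r², u² − v² − w² = rs, uv + w² = s² (in coordinates (u:v:w:r:s)) has no ℚ-rational points. -/
/-- If `A * B = X ^ 2 - 6 * Z ^ 2` with `A` prime to `6`, and no prime inert in `ℚ(√6)` divides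
both `A` and `B`, then `6` has Jacobi symbol `1` modulo `|A|`. -/
theorem jacobiSym_six_natAbs_eq_one_of_mul_eq_norm (n : ℕ) :
    ∀ A B X Z : ℤ, A.natAbs = n → IsCoprime A 6 → A * B = X ^ 2 - 6 * Z ^ 2 →
      (∀ p : ℕ, p.Prime → jacobiSym 6 p = -1 → (p : ℤ) ∣ A → ¬ (p : ℤ) ∣ B) →
      jacobiSym 6 n = 1 := by
  induction n using Nat.strong_induction_on with
  | _ n ih =>
    intro A B X Z hn hA h hB
    have hA0 : A ≠ 0 := by
      rintro rfl
      rw [isCoprime_zero_left, Int.isUnit_iff] at hA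
      omega
    rcases eq_or_ne n 1 with rfl | hn1
    · exact jacobiSym.one_right 6
    obtain ⟨p, hp, hpn⟩ := Nat.exists_prime_and_dvd hn1
    have hpA : (p : ℤ) ∣ A := Int.natCast_dvd.2 (hn ▸ hpn)
    have hp' : Prime (p : ℤ) := Nat.prime_iff_prime_int.1 hp
    have := Fact.mk hp
    have hp6 : IsCoprime (6 : ℤ) p := (hA.of_isCoprime_of_dvd_left hpA).symm
    have hpos : 0 < n := by omega
    rcases jacobiSym.eq_one_or_neg_one (a := 6) (b := p) (Int.isCoprime_iff_gcd_eq_one.1 hp6) with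
      h1 | h1
    · obtain ⟨A', rfl⟩ := hpA
      rw [Int.natAbs_mul, Int.natAbs_natCast] at hn
      have hA'0 : 0 < A'.natAbs := Int.natAbs_pos.2 (right_ne_zero_of_mul hA0)
      have hlt : A'.natAbs < n := by
        rw [← hn]; exact lt_mul_of_one_lt_left hA'0 hp.one_lt
      have hJ := ih _ hlt A' (p * B) X Z rfl hA.of_mul_left_right (by linarith) (by
        intro q hq hq1 hqA hqB
        have hq' : Prime (q : ℤ) := Nat.prime_iff_prime_int.1 hq
        rcases hq'.dvd_or_dvd hqB with hqp | hqB
        · rw [Int.natCast_dvd_natCast, Nat.prime_dvd_prime_iff_eq hq hp] at hqp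
          rw [hqp, h1] at hq1
          norm_num at hq1
        · exact hB q hq hq1 (hqA.mul_left _) hqB)
      have : NeZero p := ⟨hp.ne_zero⟩
      have : NeZero A'.natAbs := ⟨hA'0.ne'⟩
      rw [← hn, jacobiSym.mul_right, h1, hJ, one_mul]
    · have hleg : legendreSym p 6 = -1 := by rw [jacobiSym.legendreSym.to_jacobiSym, h1]
      have hdvd := legendreSym.prime_dvd_of_eq_neg_one (x := X) (y := Z) hleg
        (h ▸ hpA.mul_right B)
      obtain ⟨⟨X', rfl⟩, Z', rfl⟩ := hdvd
      have hpB := hB p hp h1 hpA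
      have hp2 : (p : ℤ) ^ 2 ∣ A := by
        refine (hp'.coprime_iff_not_dvd.2 hpB).pow_left.dvd_of_dvd_mul_right ?_
        exact ⟨X' ^ 2 - 6 * Z' ^ 2, by rw [h]; ring⟩
      obtain ⟨A', rfl⟩ := hp2
      rw [Int.natAbs_mul, Int.natAbs_pow, Int.natAbs_natCast] at hn
      have hA'0 : 0 < A'.natAbs := Int.natAbs_pos.2 (right_ne_zero_of_mul hA0)
      have hlt : A'.natAbs < n := by
        rw [← hn]; exact lt_mul_of_one_lt_left hA'0 (Nat.one_lt_pow two_ne_zero hp.one_lt)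
      have hJ := ih _ hlt A' B X' Z' rfl hA.of_mul_left_right
        (mul_left_cancel₀ (pow_ne_zero 2 hp'.ne_zero) (by linear_combination h))
        (fun q hq hq1 hqA => hB q hq hq1 (hqA.mul_left _))
      have : NeZero p := ⟨hp.ne_zero⟩
      have : NeZero A'.natAbs := ⟨hA'0.ne'⟩
      rw [← hn, jacobiSym.mul_right, jacobiSym.pow_right, h1, hJ]
      norm_num

theorem jacobiSym_six_natAbs_eq_neg_one {L : ℤ} (h : L % 24 = 13 ∨ L % 24 = 17) :
    jacobiSym 6 L.natAbs = -1 := by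
  have hodd : Odd L.natAbs := by rw [Nat.odd_iff]; omega
  rw [jacobiSym.mod_right 6 hodd]
  have h24 : 4 * (6 : ℤ).natAbs = 24 := rfl
  rw [h24]
  have : L.natAbs % 24 = 7 ∨ L.natAbs % 24 = 11 ∨ L.natAbs % 24 = 13 ∨ L.natAbs % 24 = 17 := by
    omega
  rcases this with h | h | h | h <;> rw [h] <;> norm_num

/-- The linear form `24 * u + w + 2 * t` is tangent to the quadric
`t ^ 2 = 120 * u ^ 2 + 144 * u * v - 95 * v ^ 2 + 25 * v * w - w ^ 2`; its product with its
conjugate is, up to the factor `5`, a norm from `ℚ(√6)`. -/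
theorem jacobiSym_six_tangent_eq_one {u v w t : ℤ} (hvw : IsCoprime v w)
    (ht : t ^ 2 = 120 * u ^ 2 + 144 * u * v - 95 * v ^ 2 + 25 * v * w - w ^ 2)
    (h6 : IsCoprime (24 * u + w + 2 * t) 6) :
    jacobiSym 6 (24 * u + w + 2 * t).natAbs = 1 := by
  have hN : (24 * u + w + 2 * t) * (5 * (24 * u + w - 2 * t)) =
      (24 * u + 5 * w - 50 * v) ^ 2 - 6 * (2 * (2 * u + 5 * v)) ^ 2 := by
    linear_combination -20 * ht
  refine jacobiSym_six_natAbs_eq_one_of_mul_eq_norm _ _ _ _ _ rfl h6 hN ?_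
  intro p hp hJ hpA hpB
  have := Fact.mk hp
  have hp' : Prime (p : ℤ) := Nat.prime_iff_prime_int.1 hp
  have hne : ∀ q : ℕ, q.Prime → jacobiSym 6 q ≠ -1 → ¬ (p : ℤ) ∣ q := by
    intro q hq hq1 hpq
    rw [Int.natCast_dvd_natCast, Nat.prime_dvd_prime_iff_eq hp hq] at hpq
    exact hq1 (hpq ▸ hJ)
  have hp2 : ¬ (p : ℤ) ∣ 2 := hne 2 (by norm_num) (by norm_num)
  have hp5 : ¬ (p : ℤ) ∣ 5 := hne 5 (by norm_num) (by norm_num)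
  have hp19 : ¬ (p : ℤ) ∣ 19 := hne 19 (by norm_num) (by norm_num)
  have hleg : legendreSym p 6 = -1 := by rw [jacobiSym.legendreSym.to_jacobiSym, hJ]
  obtain ⟨hX, hZ⟩ := legendreSym.prime_dvd_of_eq_neg_one hleg (hN ▸ hpA.mul_right _)
  have hY := (hp'.dvd_or_dvd hZ).resolve_left hp2
  have hB := (hp'.dvd_or_dvd hpB).resolve_left hp5
  have hS : (p : ℤ) ∣ 24 * u + w := by
    refine (hp'.dvd_or_dvd (?_ : (p : ℤ) ∣ 2 * (24 * u + w))).resolve_left hp2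
    have := dvd_add hpA hB
    ring_nf at this ⊢
    exact this
  have hu : (p : ℤ) ∣ u := by
    have h76 : (p : ℤ) ∣ 2 * (2 * (19 * u)) := by
      have := dvd_sub (dvd_sub (hS.mul_left 5) hX) (hY.mul_left 10)
      ring_nf at this ⊢
      exact this
    exact (hp'.dvd_or_dvd ((hp'.dvd_or_dvd ((hp'.dvd_or_dvd h76).resolve_left hp2)).resolve_left
      hp2)).resolve_left hp19
  have hw : (p : ℤ) ∣ w := (dvd_add_right (hu.mul_left 24)).1 hS
  have hv : (p : ℤ) ∣ v :=
    (hp'.dvd_or_dvd ((dvd_add_right (hu.mul_left 2)).1 hY)).resolve_left hp5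
  exact hp'.not_isUnit (hvw.isUnit_of_dvd' hv hw)

/-- The coordinates `v = a² + b²`, `w = 2 * a * b + b²`, `r = a² + ab - b²` parametrize the conic
`v² + vw - w² = r²`; no point with `a`, `b` odd lifts to the curve. -/
theorem genus5_curve_param_false {u v w r s a b : ℤ} (hvw : IsCoprime v w)
    (h₁ : v ^ 2 + v * w - w ^ 2 = r ^ 2) (h₂ : u ^ 2 - v ^ 2 - w ^ 2 = r * s)
    (h₃ : u * v + w ^ 2 = s ^ 2) (ha : Odd a) (hb : Odd b)
    (hv : v = a ^ 2 + b ^ 2) (hw : w = 2 * (a * b) + b ^ 2) (hr : r = a ^ 2 + a * b - b ^ 2) :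
    False := by
  have contra : ∀ t : ℤ,
      t ^ 2 = 120 * u ^ 2 + 144 * u * v - 95 * v ^ 2 + 25 * v * w - w ^ 2 →
      ¬ ((24 * u + w + 2 * t) % 24 = 13 ∨ (24 * u + w + 2 * t) % 24 = 17) := by
    intro t ht hmod
    have h6 : IsCoprime (24 * u + w + 2 * t) 6 := by
      have : (24 * u + w + 2 * t) % 6 = 1 ∨ (24 * u + w + 2 * t) % 6 = 5 := by omega
      rcases this with h | h
      · exact ⟨1, -((24 * u + w + 2 * t) / 6), by omega⟩
      · exact ⟨-1, (24 * u + w + 2 * t) / 6 + 1, by omega⟩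
    have := jacobiSym_six_tangent_eq_one hvw ht h6
    rw [jacobiSym_six_natAbs_eq_neg_one hmod] at this
    norm_num at this
  have sq8 : ∀ c : ℤ, Odd c → c ^ 2 % 8 = 1 := by
    intro c hc
    rw [Int.odd_iff] at hc
    have : c % 8 = 1 ∨ c % 8 = 3 ∨ c % 8 = 5 ∨ c % 8 = 7 := by omega
    rcases this with h | h | h | h <;> simp [pow_two, Int.mul_emod, h]
  have ha8 := sq8 a ha
  have hb8 := sq8 b hb
  have hab : a * b % 2 = 1 := Int.odd_iff.1 (ha.mul hb)
  have hplus := contra (5 * r + 12 * s) (by linear_combination -25 * h₁ - 120 * h₂ - 144 * h₃)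
  have hminus := contra (-(5 * r + 12 * s)) (by
    linear_combination -25 * h₁ - 120 * h₂ - 144 * h₃)
  have sq3 : ∀ c : ℤ, ¬ 3 ∣ c → c ^ 2 % 3 = 1 := by
    intro c hc
    have : c % 3 = 1 ∨ c % 3 = 2 := by omega
    rcases this with h | h <;> simp [pow_two, Int.mul_emod, h]
  by_cases ha3 : (3 : ℤ) ∣ a
  · have hb3 : ¬ (3 : ℤ) ∣ b := by
      intro hb3
      refine Int.prime_three.not_isUnit (hvw.isUnit_of_dvd' ?_ ?_)
      · rw [hv]
        exact dvd_add (dvd_pow ha3 two_ne_zero) (dvd_pow hb3 two_ne_zero)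
      · rw [hw]
        exact dvd_add ((ha3.mul_right b).mul_left 2) (dvd_pow hb3 two_ne_zero)
    have h1 := sq3 b hb3
    have h2 : a ^ 2 % 3 = 0 := Int.emod_eq_zero_of_dvd (dvd_pow ha3 two_ne_zero)
    have h3 : a * b % 3 = 0 := Int.emod_eq_zero_of_dvd (ha3.mul_right b)
    omega
  · have h1 := sq3 a ha3
    omega

theorem genus5_curve_false_of_sq {u v w r s x y : ℤ} (hvw : IsCoprime v w) (hv : Even v)
    (h₁ : v ^ 2 + v * w - w ^ 2 = r ^ 2) (h₂ : u ^ 2 - v ^ 2 - w ^ 2 = r * s)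
    (h₃ : u * v + w ^ 2 = s ^ 2)
    (hx : 2 * v + w + 2 * r = x ^ 2) (hy : 2 * v + w - 2 * r = 5 * y ^ 2) : False := by
  wlog hw : w = x * y generalizing y
  · refine this (y := -y) (by rw [hy]; ring) ?_
    have : w ^ 2 = (x * y) ^ 2 := by
      have : 5 * w ^ 2 = 5 * (x * y) ^ 2 := by
        linear_combination (2 * v + w - 2 * r) * hx + x ^ 2 * hy - 4 * h₁
      linarith
    rcases sq_eq_sq_iff_eq_or_eq_neg.1 this with h | h
    · exact absurd h hw
    · rw [h]; ring
  have hwo : Odd w := by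
    rw [← Int.not_even_iff_odd]
    intro hwe
    exact Int.prime_two.not_isUnit (hvw.isUnit_of_dvd' hv.two_dvd hwe.two_dvd)
  obtain ⟨hxo, hyo⟩ := Int.odd_mul.1 (hw ▸ hwo)
  obtain ⟨a, ha⟩ := (hxo.sub_odd hyo).two_dvd
  obtain rfl : x = 2 * a + y := by linarith
  have hv' : v = a ^ 2 + y ^ 2 := by linarith
  have hao : Odd a := by
    rw [← Int.not_even_iff_odd]
    intro hae
    have : Odd v := hv' ▸ (hae.pow_of_ne_zero two_ne_zero).add_odd hyo.pow
    exact (Int.not_even_iff_odd.2 this) hv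
  exact genus5_curve_param_false hvw h₁ h₂ h₃ hao hyo hv' (by linarith) (by linarith)

theorem genus5_curve_false_of_five_dvd {u v w r s : ℤ} (hvw : IsCoprime v w) (hv : Even v)
    (h₁ : v ^ 2 + v * w - w ^ 2 = r ^ 2) (h₂ : u ^ 2 - v ^ 2 - w ^ 2 = r * s)
    (h₃ : u * v + w ^ 2 = s ^ 2) (h5 : 5 ∣ 2 * v + w - 2 * r) : False := by
  obtain ⟨c, hc⟩ := h5
  have hprod : c * (2 * v + w + 2 * r) = w ^ 2 := by
    have : 5 * (c * (2 * v + w + 2 * r)) = 5 * w ^ 2 := by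
      linear_combination 4 * h₁ - (2 * v + w + 2 * r) * hc
    linarith
  have hw0 : w ≠ 0 := by
    rintro rfl
    rw [isCoprime_zero_right, Int.isUnit_iff] at hvw
    rcases hvw with rfl | rfl <;> revert hv <;> decide
  have hcop : IsCoprime c (2 * v + w + 2 * r) := by
    refine isCoprime_of_prime_dvd ?_ ?_
    · rintro ⟨rfl, -⟩
      exact hw0 (by simpa using hprod.symm)
    · intro p hp hpc hpd
      have hpw : p ∣ w := hp.dvd_of_dvd_pow (hprod ▸ hpc.mul_right _)
      have hp4 : p ∣ 2 * (2 * v) := by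
        have := dvd_sub (dvd_add (hpc.mul_left 5) hpd) (hpw.mul_left 2)
        rw [← hc] at this
        ring_nf at this ⊢
        exact this
      have hpv : p ∣ v := by
        rcases hp.dvd_or_dvd hp4 with h | h
        · exact h.trans hv.two_dvd
        · rcases hp.dvd_or_dvd h with h | h
          · exact h.trans hv.two_dvd
          · exact h
      exact hp.not_isUnit (hvw.isUnit_of_dvd' hpv hpw)
  obtain ⟨y, hy⟩ := Int.sq_of_isCoprime hcop hprod
  obtain ⟨x, hx⟩ := Int.sq_of_isCoprime hcop.symm (by rw [mul_comm]; exact hprod)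
  have hpos : 0 < w ^ 2 := by positivity
  rcases hy with rfl | rfl <;> rcases hx with hx | hx
  · exact genus5_curve_false_of_sq hvw hv h₁ h₂ h₃ hx hc
  · rw [hx] at hprod
    nlinarith [mul_nonneg (sq_nonneg x) (sq_nonneg y)]
  · rw [hx] at hprod
    nlinarith [mul_nonneg (sq_nonneg x) (sq_nonneg y)]
  · exact genus5_curve_false_of_sq (u := -u) (v := -v) (w := -w) (r := -r) (s := -s) (x := x)
      (y := y) hvw.neg_neg hv.neg (by linarith) (by linarith) (by linarith) (by linarith)
      (by linarith)

theorem genus5_curve_not_isCoprime {u v w r s : ℤ}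
    (h₁ : v ^ 2 + v * w - w ^ 2 = r ^ 2) (h₂ : u ^ 2 - v ^ 2 - w ^ 2 = r * s)
    (h₃ : u * v + w ^ 2 = s ^ 2) : ¬ IsCoprime v w := by
  intro hvw
  have hv : Even v := by
    have key : ∀ u v w r s : ZMod 2, v ^ 2 + v * w - w ^ 2 = r ^ 2 →
        u ^ 2 - v ^ 2 - w ^ 2 = r * s → u * v + w ^ 2 = s ^ 2 → v = 0 := by decide
    rw [← ZMod.intCast_eq_zero_iff_even]
    exact key u v w r s (by exact_mod_cast congrArg (Int.cast : ℤ → ZMod 2) h₁)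
      (by exact_mod_cast congrArg (Int.cast : ℤ → ZMod 2) h₂)
      (by exact_mod_cast congrArg (Int.cast : ℤ → ZMod 2) h₃)
  have h5 : (5 : ℤ) ∣ (2 * v + w - 2 * r) * (2 * v + w + 2 * r) :=
    ⟨w ^ 2, by linear_combination 4 * h₁⟩
  have hp5 : Prime (5 : ℤ) := Nat.prime_iff_prime_int.1 Nat.prime_five
  rcases hp5.dvd_or_dvd h5 with h | h
  · exact genus5_curve_false_of_five_dvd hvw hv h₁ h₂ h₃ h
  · exact genus5_curve_false_of_five_dvd (u := u) (r := -r) (s := -s) hvw hv (by linarith) (by linarith)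
      (by linarith) (by simpa using h)

/-- A rational point of the curve whose coordinates `v` and `w` are integers is integral. -/
theorem genus5_curve_integral {v w : ℤ} {u r s : ℚ}
    (h₁ : (v : ℚ) ^ 2 + v * w - w ^ 2 = r ^ 2) (h₂ : u ^ 2 - v ^ 2 - w ^ 2 = r * s)
    (h₃ : u * v + w ^ 2 = s ^ 2) :
    ∃ u' r' s' : ℤ, (u' : ℚ) = u ∧ (r' : ℚ) = r ∧ (s' : ℚ) = s := by
  have exists_int : ∀ q : ℚ, IsIntegral ℤ q → ∃ n : ℤ, (n : ℚ) = q := fun q hq =>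
    IsIntegrallyClosed.isIntegral_iff.1 hq
  have hint : ∀ n : ℤ, IsIntegral ℤ (n : ℚ) := fun n => isIntegral_algebraMap
  obtain ⟨r', rfl⟩ := exists_int r <| IsIntegral.of_pow two_pos <| by
    rw [← h₁]
    convert hint (v ^ 2 + v * w - w ^ 2) using 1
    push_cast
    rfl
  obtain ⟨u', rfl⟩ := exists_int u <| by
    refine ⟨(Polynomial.X ^ 2 - Polynomial.C (v ^ 2 + w ^ 2)) ^ 2 -
      (Polynomial.C (r' ^ 2 * v) * Polynomial.X + Polynomial.C (r' ^ 2 * w ^ 2)), ?_, ?_⟩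
    · monicity!
    · simp only [Polynomial.eval₂_sub, Polynomial.eval₂_add, Polynomial.eval₂_mul,
        Polynomial.eval₂_pow, Polynomial.eval₂_X, Polynomial.eval₂_C]
      simp only [eq_intCast]
      push_cast
      linear_combination (u ^ 2 - v ^ 2 - w ^ 2 + r' * s) * h₂ - r' ^ 2 * h₃
  obtain ⟨s', rfl⟩ := exists_int s <| IsIntegral.of_pow two_pos <| by
    rw [← h₃]
    convert hint (u' * v + w ^ 2) using 1
    push_cast
    rfl
  exact ⟨u', r', s', rfl, rfl, rfl⟩

theorem Rat.exists_isCoprime_smul {v w : ℚ} (h : ¬ (v = 0 ∧ w = 0)) :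
    ∃ (q : ℚ) (v' w' : ℤ), q ≠ 0 ∧ IsCoprime v' w' ∧ v = q * v' ∧ w = q * w' := by
  have hd : (v.den * w.den : ℚ) ≠ 0 :=
    mul_ne_zero (Nat.cast_ne_zero.2 v.den_ne_zero) (Nat.cast_ne_zero.2 w.den_ne_zero)
  have hg : Int.gcd (v.num * w.den) (w.num * v.den) ≠ 0 := by
    rw [Ne, Int.gcd_eq_zero_iff]
    simpa using h
  obtain ⟨v', w', hcop, hv, hw⟩ := Int.exists_gcd_one (Nat.pos_of_ne_zero hg)
  refine ⟨Int.gcd (v.num * w.den) (w.num * v.den) / (v.den * w.den), v', w',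
    div_ne_zero (Nat.cast_ne_zero.2 hg) hd, Int.isCoprime_iff_gcd_eq_one.2 hcop, ?_, ?_⟩
  · have hv' : (v.num * w.den : ℚ) = v' * Int.gcd (v.num * w.den) (w.num * v.den) := by
      exact_mod_cast hv
    rw [div_mul_eq_mul_div, mul_comm _ (v' : ℚ), ← hv', eq_div_iff hd, ← mul_assoc,
      Rat.mul_den_eq_num]
  · have hw' : (w.num * v.den : ℚ) = w' * Int.gcd (v.num * w.den) (w.num * v.den) := by
      exact_mod_cast hw
    rw [div_mul_eq_mul_div, mul_comm _ (w' : ℚ), ← hw', eq_div_iff hd, mul_comm (v.den : ℚ),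
      ← mul_assoc, Rat.mul_den_eq_num]

/-- The genus 5 curve `D ⊂ P⁴` defined by
`v² + vw − w² = r²`, `u² − v² − w² = rs`, `uv + w² = s²` has no rational points:
the only rational solution of the system is the zero quintuple. -/
theorem genus5_curve_no_rational_points :
    ∀ u v w r s : ℚ,
      v ^ 2 + v * w - w ^ 2 = r ^ 2 →
      u ^ 2 - v ^ 2 - w ^ 2 = r * s →
      u * v + w ^ 2 = s ^ 2 →
      u = 0 ∧ v = 0 ∧ w = 0 ∧ r = 0 ∧ s = 0 := by
  intro u v w r s h₁ h₂ h₃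
  by_cases hvw : v = 0 ∧ w = 0
  · obtain ⟨rfl, rfl⟩ := hvw
    have hr : r = 0 := by simpa using h₁.symm
    have hs : s = 0 := by simpa using h₃.symm
    have hu : u = 0 := by simpa [hr] using h₂
    exact ⟨hu, rfl, rfl, hr, hs⟩
  · obtain ⟨q, v', w', hq, hcop, rfl, rfl⟩ := Rat.exists_isCoprime_smul hvw
    have h₁' : (v' : ℚ) ^ 2 + v' * w' - w' ^ 2 = (r / q) ^ 2 := by
      field_simp
      linear_combination h₁
    have h₂' : (u / q) ^ 2 - v' ^ 2 - w' ^ 2 = r / q * (s / q) := by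
      field_simp
      linear_combination h₂
    have h₃' : u / q * v' + (w' : ℚ) ^ 2 = (s / q) ^ 2 := by
      field_simp
      linear_combination h₃
    obtain ⟨u', r', s', hu, hr, hs⟩ := genus5_curve_integral h₁' h₂' h₃'
    rw [← hr] at h₁' h₂'
    rw [← hu, ← hs] at h₂' h₃'
    exact absurd hcop (genus5_curve_not_isCoprime (by exact_mod_cast h₁') (by exact_mod_cast h₂')
      (by exact_mod_cast h₃'))
end
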